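/- arXiv:1502.04322 — 3 statements merged into one kernel-verified Lean document; each statement's English description precedes it below -/
import Mathlib

section
/- Let 𝒢=(V,E) be a finite graph embedded in the complex plane with non-intersecting straight edges, let x=(x_ē)_{ē∈E} be real edge weights, and let Λ be the associated transition matrix indexed by directed edges. Let Z = Σ_{H⊆E even} ∏_{ē∈H} x_ē, where a set H⊆E is called even if every vertex of the graph (V,H) has even degree, and the product over the empty set is 1. Then det(Id − Λ) = Z², where Id is the identity matrix indexed by directed edges. -/
open scoped BigOperators

/-- The straight line segment drawn for an (unordered) edge, given the
positions of the vertices in the complex plane. -/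
def segOf {α : Type*} (pos : α → ℂ) : Sym2 α → Set ℂ :=
  Sym2.lift ⟨fun u v => segment ℝ (pos u) (pos v), fun u v => segment_symm ℝ (pos u) (pos v)⟩

/-- A finite graph embedded in the complex plane: vertices are distinct points
of `ℂ`, edges are unordered pairs of distinct vertices drawn as straight line
segments which pairwise intersect only at common endpoints, and no vertex lies
on an edge which does not contain it. -/
structure PlaneGraph where
  V : Type
  fintypeV : Fintype V
  decEqV : DecidableEq V
  pos : V → ℂ
  pos_inj : Function.Injective pos
  E : Finset (Sym2 V)
  not_diag : ∀ e ∈ E, ¬ e.IsDiag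
  edges_meet : ∀ e₁ ∈ E, ∀ e₂ ∈ E, e₁ ≠ e₂ → ∀ p : ℂ,
    p ∈ segOf pos e₁ → p ∈ segOf pos e₂ → ∃ w : V, w ∈ e₁ ∧ w ∈ e₂ ∧ p = pos w
  vertex_on_edge : ∀ e ∈ E, ∀ w : V, pos w ∈ segOf pos e → w ∈ e

attribute [instance] PlaneGraph.fintypeV PlaneGraph.decEqV

namespace PlaneGraph

variable (G : PlaneGraph)

/-- A directed edge: an ordered pair of vertices whose underlying
unordered pair is an edge of the graph. -/
abbrev DEdge : Type := {p : G.V × G.V // s(p.1, p.2) ∈ G.E}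

/-- The reversal `-e` of a directed edge. -/
def rev (e : G.DEdge) : G.DEdge :=
  ⟨(e.val.2, e.val.1), by rw [Sym2.eq_swap]; exact e.property⟩

/-- The undirected version `ē` of a directed edge. -/
def undir (e : G.DEdge) : Sym2 G.V := s(e.val.1, e.val.2)

/-- The turning angle `∠(e,g) = Arg((h_g - t_g)/(h_e - t_e)) ∈ (-π, π]`. -/
noncomputable def tangle (e g : G.DEdge) : ℝ :=
  Complex.arg ((G.pos g.val.2 - G.pos g.val.1) / (G.pos e.val.2 - G.pos e.val.1))

/-- The Kac–Ward transition matrix `Λ`, indexed by directed edges. -/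
noncomputable def transMatrix (x : Sym2 G.V → ℝ) : Matrix G.DEdge G.DEdge ℂ :=
  fun e g =>
    if e.val.2 = g.val.1 ∧ g ≠ G.rev e then
      (x (G.undir e) : ℂ) * Complex.exp (Complex.I / 2 * (G.tangle e g : ℂ))
    else 0

/-- A non-backtracking walk of length `n ≥ 1`, encoded as the list
`(w₁, …, w_{n+1})` of its `n+1` directed edges: consecutive edges are
incident head-to-tail and the walk never immediately reverses an edge. -/
def IsWalk (l : List G.DEdge) : Prop :=
  2 ≤ l.length ∧ l.Chain' (fun e g => e.val.2 = g.val.1 ∧ g ≠ G.rev e)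

/-- The length `|w|` (number of steps) of a walk given as a list of edges. -/
def len (l : List G.DEdge) : ℕ := l.length - 1

/-- The weight `λ(w) = ∏_{i=1}^{n} Λ_{w_i, w_{i+1}}` of a walk. -/
noncomputable def wlam (x : Sym2 G.V → ℝ) (l : List G.DEdge) : ℂ :=
  (List.zipWith (fun e g => G.transMatrix x e g) l l.tail).prod

/-- The edge weight `x(w) = ∏_{i=1}^{n} x_{\bar{w_i}}` of a walk
(the weight of the last edge is not included). -/
def wx (x : Sym2 G.V → ℝ) (l : List G.DEdge) : ℝ :=
  (l.dropLast.map (fun e => x (G.undir e))).prod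

/-- The total turning angle `α(w) = Σ_{i=1}^{n} ∠(w_i, w_{i+1})` of a walk. -/
noncomputable def walpha (l : List G.DEdge) : ℝ :=
  (List.zipWith (fun e g => G.tangle e g) l l.tail).sum

/-- The reversal `w⁻¹ = (-w_{n+1}, …, -w₁)` of a walk. -/
def wrev (l : List G.DEdge) : List G.DEdge := (l.map G.rev).reverse

/-- The concatenation `w ⊕ w'` of two walks, the first ending with the
directed edge with which the second starts. -/
def wconcat (l l' : List G.DEdge) : List G.DEdge := l ++ l'.tail

/-- A (rooted) loop: a walk of length at least `2` which starts and ends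
with the same directed edge. -/
def IsLoop (l : List G.DEdge) : Prop :=
  G.IsWalk l ∧ 3 ≤ l.length ∧ l.head? = l.getLast?

/-- The number of times a loop `ℓ = (ℓ₁, …, ℓ_{n+1})` visits a directed
edge `e`, i.e. the number of occurrences of `e` among `ℓ₁, …, ℓ_n`. -/
def visits (l : List G.DEdge) (e : G.DEdge) : ℕ := l.dropLast.count e

/-- A loop `ℓ` of length `n` is self-avoiding if each vertex appearing in it
appears in exactly two of the directed edges `ℓ₁, …, ℓ_n`. -/
def SelfAvoiding (l : List G.DEdge) : Prop :=
  G.IsLoop l ∧ ∀ v : G.V,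
    l.dropLast.countP (fun e => decide (v = e.val.1 ∨ v = e.val.2)) ≠ 0 →
    l.dropLast.countP (fun e => decide (v = e.val.1 ∨ v = e.val.2)) = 2

/-- The degree of a vertex: the number of edges containing it. -/
def degV (v : G.V) : ℕ := (G.E.filter (fun e => v ∈ e)).card

/-- A finite set of edges is even if every vertex belongs to an even number
of its edges. -/
def IsEvenSet (H : Finset (Sym2 G.V)) : Prop :=
  ∀ v : G.V, Even ((H.filter (fun e => v ∈ e)).card)

instance : DecidablePred G.IsEvenSet := fun H =>
  decidable_of_iff (∀ v : G.V, Even ((H.filter (fun e => v ∈ e)).card)) Iff.rfl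

/-- The generating function `Z = Σ_{H even} ∏_{ē ∈ H} x_ē` of even
subgraphs. -/
def Z (x : Sym2 G.V → ℝ) : ℝ :=
  ∑ H ∈ G.E.powerset.filter G.IsEvenSet, ∏ e ∈ H, x e

end PlaneGraph

section Pfaffian

open Matrix Equiv

variable {n R : Type*} [Fintype n] [DecidableEq n] [CommRing R]

/-- The unnormalized Pfaffian. -/
def pfSum (A : Matrix (n ⊕ n) (n ⊕ n) R) : R :=
  ∑ σ : Perm (n ⊕ n), ((Perm.sign σ : ℤ) : R) * ∏ i, A (σ (Sum.inl i)) (σ (Sum.inr i))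

theorem pfSum_submatrix (A : Matrix (n ⊕ n) (n ⊕ n) R) (π : Perm (n ⊕ n)) :
    pfSum (A.submatrix π π) = ((Perm.sign π : ℤ) : R) * pfSum A := by
  unfold pfSum
  rw [Finset.mul_sum]
  refine Fintype.sum_equiv (Equiv.mulLeft π) _ _ fun σ => ?_
  have h : ((Perm.sign π : ℤ) : R) * ((Perm.sign π : ℤ) : R) = 1 := by
    rw [← Int.cast_mul, ← Units.val_mul, Int.units_mul_self]; simp
  simp only [Equiv.coe_mulLeft, Perm.sign_mul, Units.val_mul, Int.cast_mul, submatrix_apply,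
    Perm.mul_apply]
  rw [← mul_assoc, ← mul_assoc, h, one_mul]

theorem pfSum_mul_mul_transpose (B A : Matrix (n ⊕ n) (n ⊕ n) R) :
    pfSum (B * A * Bᵀ) = det B * pfSum A := by
  have key : ∀ σ : Perm (n ⊕ n), ∏ i, (B * A * Bᵀ) (σ (Sum.inl i)) (σ (Sum.inr i)) =
      ∑ f : n ⊕ n → n ⊕ n, (∏ p, B (σ p) (f p)) * ∏ i, A (f (Sum.inl i)) (f (Sum.inr i)) := by
    intro σ
    have h1 : ∀ i, (B * A * Bᵀ) (σ (Sum.inl i)) (σ (Sum.inr i)) =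
        ∑ c : (n ⊕ n) × (n ⊕ n), B (σ (Sum.inl i)) c.1 * B (σ (Sum.inr i)) c.2 * A c.1 c.2 := by
      intro i
      simp only [mul_apply, transpose_apply, Finset.sum_mul, Fintype.sum_prod_type]
      rw [Finset.sum_comm]
      exact Finset.sum_congr rfl fun _ _ => Finset.sum_congr rfl fun _ _ => by ring
    simp only [h1, Finset.prod_univ_sum, Fintype.piFinset_univ]
    refine Fintype.sum_equiv ((Equiv.arrowProdEquivProdArrow n _ _).trans
      (Equiv.sumArrowEquivProdArrow n n (n ⊕ n)).symm) _ _ fun f => ?_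
    simp [Fintype.prod_sum_type, Finset.prod_mul_distrib, Equiv.arrowProdEquivProdArrow,
      Equiv.sumArrowEquivProdArrow]
  have hdet : ∀ f : n ⊕ n → n ⊕ n,
      ∑ σ : Perm (n ⊕ n), ((Perm.sign σ : ℤ) : R) * ∏ p, B (σ p) (f p) =
        det (B.submatrix id f) := by
    intro f
    simp [det_apply']
  unfold pfSum
  simp only [key, Finset.mul_sum]
  rw [Finset.sum_comm]
  simp only [← mul_assoc, ← Finset.sum_mul, hdet]
  rw [← Finset.sum_subset (Finset.subset_univ
    (Finset.univ.filter fun f : n ⊕ n → n ⊕ n => Function.Bijective f))]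
  · refine Finset.sum_bij' (fun f hf => Equiv.ofBijective f (Finset.mem_filter.1 hf).2)
      (fun σ _ => σ) (fun _ _ => Finset.mem_univ _)
      (fun σ _ => by simp) (fun _ _ => rfl) (fun _ _ => by ext; rfl) ?_
    intro f hf
    have : B.submatrix id f =
      B.submatrix id (Equiv.ofBijective f (Finset.mem_filter.1 hf).2) := rfl
    rw [this, det_permute']
    simp only [Equiv.ofBijective_apply]
    ring
  · intro f _ hf
    have hinj : ¬ Function.Injective f := fun h =>
      hf (by simpa using Finite.injective_iff_bijective.1 h)
    simp only [Function.Injective, not_forall] at hinj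
    obtain ⟨p, q, hpq, hne⟩ := hinj
    rw [det_zero_of_column_eq hne (fun k => by simp [hpq]), zero_mul]

theorem pfSum_J_ne_zero [IsDomain R] [CharZero R] : pfSum (J n R) ≠ 0 := by
  have key : ∀ t : Finset n,
      ∑ σ : Perm (n ⊕ n), ((Perm.sign σ : ℤ) : R) *
        ∏ i, (if i ∈ t then J n R (σ (Sum.inl i)) (σ (Sum.inr i))
          else (2 : R) * fromBlocks (0 : Matrix n n R) (-1) 0 0 (σ (Sum.inl i)) (σ (Sum.inr i))) =
      ∑ σ : Perm (n ⊕ n), ((Perm.sign σ : ℤ) : R) *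
        ∏ i, ((2 : R) *
          fromBlocks (0 : Matrix n n R) (-1) 0 0 (σ (Sum.inl i)) (σ (Sum.inr i))) := by
    intro t
    induction t using Finset.induction_on with
    | empty => simp
    | insert k t hk ih =>
      rw [← ih]
      set U : Matrix (n ⊕ n) (n ⊕ n) R := fromBlocks (0 : Matrix n n R) (-1) 0 0 with hU
      have hJ : ∀ p q, J n R p q = U p q - U q p := by
        rintro (p | p) (q | q) <;> simp [J, hU, one_apply, eq_comm]
      let C : Perm (n ⊕ n) → R := fun σ => ((Perm.sign σ : ℤ) : R) *
        ∏ i ∈ Finset.univ.erase k, (if i ∈ t then J n R (σ (Sum.inl i)) (σ (Sum.inr i))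
          else (2 : R) * U (σ (Sum.inl i)) (σ (Sum.inr i)))
      have h1 : ∀ σ : Perm (n ⊕ n), ((Perm.sign σ : ℤ) : R) *
          ∏ i, (if i ∈ insert k t then J n R (σ (Sum.inl i)) (σ (Sum.inr i))
            else (2 : R) * U (σ (Sum.inl i)) (σ (Sum.inr i))) =
          C σ * U (σ (Sum.inl k)) (σ (Sum.inr k)) -
          C σ * U (σ (Sum.inr k)) (σ (Sum.inl k)) := by
        intro σ
        rw [← Finset.mul_prod_erase _ _ (Finset.mem_univ k)]
        have : ∏ i ∈ Finset.univ.erase k,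
            (if i ∈ insert k t then J n R (σ (Sum.inl i)) (σ (Sum.inr i))
              else (2 : R) * U (σ (Sum.inl i)) (σ (Sum.inr i))) =
            ∏ i ∈ Finset.univ.erase k, (if i ∈ t then J n R (σ (Sum.inl i)) (σ (Sum.inr i))
              else (2 : R) * U (σ (Sum.inl i)) (σ (Sum.inr i))) :=
          Finset.prod_congr rfl fun i hi => by
            simp [Finset.mem_insert, Finset.ne_of_mem_erase hi]
        rw [this, if_pos (Finset.mem_insert_self _ _), hJ]
        simp only [C]; ring
      have h2 : ∀ σ : Perm (n ⊕ n), ((Perm.sign σ : ℤ) : R) *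
          ∏ i, (if i ∈ t then J n R (σ (Sum.inl i)) (σ (Sum.inr i))
            else (2 : R) * U (σ (Sum.inl i)) (σ (Sum.inr i))) =
          2 * (C σ * U (σ (Sum.inl k)) (σ (Sum.inr k))) := by
        intro σ
        rw [← Finset.mul_prod_erase _ _ (Finset.mem_univ k), if_neg hk]
        simp only [C]; ring
      have h3 : ∑ σ, C σ * U (σ (Sum.inr k)) (σ (Sum.inl k)) =
          - ∑ σ, C σ * U (σ (Sum.inl k)) (σ (Sum.inr k)) := by
        rw [← Finset.sum_neg_distrib]
        refine Fintype.sum_equiv (Equiv.mulRight (Equiv.swap (Sum.inl k) (Sum.inr k))) _ _ ?_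
        intro σ
        have hC : C (σ * Equiv.swap (Sum.inl k) (Sum.inr k)) = - C σ := by
          simp only [C, Perm.sign_mul, Perm.sign_swap (Sum.inl_ne_inr), Units.val_mul,
            Perm.mul_apply]
          rw [Finset.prod_congr rfl (g := fun i =>
            (if i ∈ t then J n R (σ (Sum.inl i)) (σ (Sum.inr i))
              else (2 : R) * U (σ (Sum.inl i)) (σ (Sum.inr i))))]
          · simp
          · intro i hi
            have := Finset.ne_of_mem_erase hi
            rw [Equiv.swap_apply_of_ne_of_ne (by simpa) (by simp),
              Equiv.swap_apply_of_ne_of_ne (by simp) (by simpa)]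
        simp only [Equiv.coe_mulRight, hC]
        simp
      simp only [h1, h2, Finset.sum_sub_distrib, h3, ← Finset.mul_sum]
      ring
  have hk := key Finset.univ
  simp only [Finset.mem_univ, if_true] at hk
  change pfSum (J n R) = _ at hk
  rw [hk]
  have hterm : ∀ σ : Perm (n ⊕ n), ((Perm.sign σ : ℤ) : R) * ∏ i, ((2 : R) *
      fromBlocks (0 : Matrix n n R) (-1) 0 0 (σ (Sum.inl i)) (σ (Sum.inr i))) =
      (-2) ^ Fintype.card n * (if ∃ π : Perm n, σ = Equiv.sumCongr π π then 1 else 0) := by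
    intro σ
    split_ifs with h
    · obtain ⟨π, rfl⟩ := h
      rw [Perm.sign_sumCongr]
      simp [Int.units_mul_self, Finset.prod_const]
    · rw [mul_zero]
      by_contra hne
      have hne' := Finset.prod_ne_zero_iff.1 (right_ne_zero_of_mul hne)
      have hex : ∀ i, ∃ j, σ (Sum.inl i) = Sum.inl j ∧ σ (Sum.inr i) = Sum.inr j := by
        intro i
        have := right_ne_zero_of_mul (hne' i (Finset.mem_univ i))
        rcases ha : σ (Sum.inl i) with a | a <;> rcases hb : σ (Sum.inr i) with b | b <;>
          rw [ha, hb] at this <;> simp [one_apply] at this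
        exact ⟨a, rfl, by rw [this]⟩
      choose g hg1 hg2 using hex
      have hginj : Function.Injective g := fun a b hab => by
        have : σ (Sum.inl a) = σ (Sum.inl b) := by rw [hg1, hg1, hab]
        simpa using this
      refine h ⟨Equiv.ofBijective g (Finite.injective_iff_bijective.1 hginj), ?_⟩
      ext (i | i) <;> simp [hg1, hg2]
  simp only [hterm, ← Finset.mul_sum, Finset.sum_boole]
  refine mul_ne_zero (pow_ne_zero _ (by norm_num)) (Nat.cast_ne_zero.2 ?_)
  exact Finset.card_ne_zero_of_mem
    (Finset.mem_filter.2 ⟨Finset.mem_univ 1, 1, by ext (i | i) <;> rfl⟩)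

end Pfaffian

section Alternating

open Matrix

variable {m n K : Type*} [Fintype n] [DecidableEq n] [DecidableEq m] [Field K] [CharZero K]

/-- An alternating matrix supported on at most `2 * k` indices is a sum of `k` rank-two
alternating matrices. -/
theorem exists_sum_wedge_of_transpose_eq_neg (k : ℕ) (S : Finset m) (hS : S.card ≤ 2 * k)
    (A : Matrix m m K) (hA : Aᵀ = -A) (hsupp : ∀ p q, A p q ≠ 0 → p ∈ S) :
    ∃ u v : Fin k → m → K, ∀ p q, A p q = ∑ t, (u t p * v t q - v t p * u t q) := by
  induction k generalizing S A with
  | zero =>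
    refine ⟨0, 0, fun p q => ?_⟩
    by_contra h
    have h0 : S = ∅ := by simpa using hS
    have := hsupp p q (by simpa using h)
    simp [h0] at this
  | succ k ih =>
    have hanti : ∀ p q, A q p = -A p q := fun p q => by
      simpa using congrFun (congrFun hA p) q
    have hdiag : ∀ p, A p p = 0 := fun p => self_eq_neg.1 (hanti p p)
    by_cases h0 : ∃ i j, A i j ≠ 0
    · obtain ⟨i, j, hij⟩ := h0
      have hne : i ≠ j := by rintro rfl; exact hij (hdiag i)
      have hi : i ∈ S := hsupp i j hij
      have hj : j ∈ S := hsupp j i (by rw [hanti i j]; simpa using hij)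
      let u : m → K := fun p => -(A i j)⁻¹ * A p j
      let v : m → K := fun p => A p i
      let A' : Matrix m m K := of fun p q => A p q - (u p * v q - v p * u q)
      have hcard : ((S.erase i).erase j).card ≤ 2 * k := by
        rw [Finset.card_erase_of_mem (Finset.mem_erase.2 ⟨hne.symm, hj⟩),
          Finset.card_erase_of_mem hi]
        omega
      obtain ⟨u', v', h⟩ := ih ((S.erase i).erase j) hcard A'
        (by
          ext p q
          simp only [transpose_apply, Matrix.neg_apply, A', of_apply, hanti p q]
          ring)
        (by
          intro p q hpq
          have hpi : p ≠ i := by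
            rintro rfl
            apply hpq
            simp only [A', of_apply, u, v, hdiag, hanti p q]
            field_simp
            ring
          have hpj : p ≠ j := by
            rintro rfl
            apply hpq
            simp only [A', of_apply, u, v, hdiag, hanti p q, hanti i p]
            field_simp
            ring
          refine Finset.mem_erase.2 ⟨hpj, Finset.mem_erase.2 ⟨hpi, ?_⟩⟩
          by_contra hp
          have hz : ∀ q, A p q = 0 := fun q => by_contra fun h => hp (hsupp p q h)
          exact hpq (by simp [A', u, v, hz]))
      refine ⟨Fin.cons u u', Fin.cons v v', fun p q => ?_⟩
      rw [Fin.sum_univ_succ]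
      simp only [Fin.cons_zero, Fin.cons_succ, ← h, A', of_apply]
      ring
    · push Not at h0
      exact ⟨0, 0, fun p q => by simp [h0]⟩

theorem exists_eq_mul_J_mul_transpose (A : Matrix (n ⊕ n) (n ⊕ n) K) (hA : Aᵀ = -A) :
    ∃ B : Matrix (n ⊕ n) (n ⊕ n) K, A = B * J n K * Bᵀ := by
  obtain ⟨u, v, h⟩ := exists_sum_wedge_of_transpose_eq_neg (Fintype.card n) Finset.univ
    (by rw [Finset.card_univ, Fintype.card_sum]; omega) A hA (fun _ _ _ => Finset.mem_univ _)
  let e := Fintype.equivFin n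
  let X : Matrix (n ⊕ n) n K := of fun p i => u (e i) p
  let Y : Matrix (n ⊕ n) n K := of fun p i => v (e i) p
  have hB : fromCols Y X * J n K * (fromCols Y X)ᵀ = X * Yᵀ - Y * Xᵀ := by
    rw [J, fromCols_mul_fromBlocks, transpose_fromCols, fromCols_mul_fromRows]
    simp [sub_eq_add_neg]
  refine ⟨fromCols Y X, ?_⟩
  rw [hB]
  ext p q
  rw [h, ← e.sum_comp]
  simp [mul_apply, X, Y, Finset.sum_sub_distrib]

/-- The square of the (unnormalized) Pfaffian of an alternating matrix. -/
theorem pfSum_sq (A : Matrix (n ⊕ n) (n ⊕ n) K) (hA : Aᵀ = -A) :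
    pfSum A ^ 2 = det (-(J n K * A)) * pfSum (J n K) ^ 2 := by
  obtain ⟨B, rfl⟩ := exists_eq_mul_J_mul_transpose A hA
  have hJ : det (-(J n K * J n K)) = 1 := by rw [J_squared, neg_neg, det_one]
  have : det (-(J n K * (B * J n K * Bᵀ))) = det B ^ 2 := by
    have h : -(J n K * (B * J n K * Bᵀ)) = (-J n K) * B * J n K * Bᵀ := by
      simp [Matrix.mul_assoc]
    rw [← Matrix.neg_mul, det_mul] at hJ
    rw [h, det_mul, det_mul, det_mul, det_transpose]
    linear_combination det B ^ 2 * hJ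
  rw [this, pfSum_mul_mul_transpose]
  ring

/-- Adding to `J` an alternating matrix that does not distinguish `Sum.inl i` from `Sum.inr i`
does not change the Pfaffian. -/
theorem pfSum_J_add_fromBlocks (U : Matrix n n K) (hU : Uᵀ = -U) :
    pfSum (J n K + fromBlocks U U U U) = pfSum (J n K) := by
  let N : Matrix n n K := (1 / 2 : K) • U
  have hN : Nᵀ = -N := by simp [N, transpose_smul, hU]
  have hUN : U = N + N := by
    simp only [N, ← add_smul]; norm_num
  let B : Matrix (n ⊕ n) (n ⊕ n) K := fromBlocks (1 - N) N (-N) (1 + N)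
  have hB : det B = 1 := by
    have : B = 1 + fromRows (1 : Matrix n n K) 1 * fromCols (-N) N := by
      ext (i | i) (j | j) <;> simp [B, one_apply, sub_eq_add_neg]
    rw [this, det_one_add_mul_comm, fromCols_mul_fromRows]
    simp
  have h : J n K + fromBlocks U U U U = B * J n K * Bᵀ := by
    rw [hUN]
    simp only [J, B, fromBlocks_transpose, fromBlocks_multiply, fromBlocks_add, transpose_add,
      transpose_sub, transpose_neg, transpose_one, hN]
    congr 1 <;> noncomm_ring
  rw [h, pfSum_mul_mul_transpose, hB, one_mul]

end Alternating

theorem eq_inl_or_inr_of_elim_eq {n : Type*} {p : n ⊕ n} {e : n} (h : p.elim id id = e) :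
    p = Sum.inl e ∨ p = Sum.inr e := by
  rcases p with p | p <;> simp_all

section Expansion

open Matrix Equiv

variable {n R : Type*} [DecidableEq n] [CommRing R]

/-- The matrix equal to `T` on the pairs indexed by `H` and to `J` on the other pairs. -/
def restrictPairs (H : Finset n) (T : Matrix (n ⊕ n) (n ⊕ n) R) : Matrix (n ⊕ n) (n ⊕ n) R :=
  of fun p q =>
    if p.elim id id ∈ H ∧ q.elim id id ∈ H then T p q
    else if p.elim id id ∉ H ∧ q.elim id id ∉ H then J n R p q else 0

theorem J_apply_of_ne {p q : n ⊕ n} (h : p.elim id id ≠ q.elim id id) : J n R p q = 0 := by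
  rcases p with p | p <;> rcases q with q | q <;> simp_all [J, one_apply]

variable [Fintype n]

theorem pfSum_J_add_diagonal_mul (T : Matrix (n ⊕ n) (n ⊕ n) R)
    (h₁ : ∀ i, T (Sum.inl i) (Sum.inr i) = 0) (h₂ : ∀ i, T (Sum.inr i) (Sum.inl i) = 0)
    (x : n → R) :
    pfSum (J n R + diagonal (Sum.elim x 1) * T * diagonal (Sum.elim x 1)) =
      ∑ H : Finset n, (∏ i ∈ H, x i) * pfSum (restrictPairs H T) := by
  let d : Finset n → n ⊕ n → R := fun H => Sum.elim (fun i => if i ∈ H then x i else 1) 1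
  have hdet : ∀ H : Finset n, (∏ i ∈ H, x i) * pfSum (restrictPairs H T) =
      pfSum (diagonal (d H) * restrictPairs H T * diagonal (d H)) := by
    intro H
    have : det (diagonal (d H)) = ∏ i ∈ H, x i := by
      simp [det_diagonal, d, Fintype.prod_sum_type]
    rw [← this, ← pfSum_mul_mul_transpose, diagonal_transpose]
  simp only [hdet]
  unfold pfSum
  rw [Finset.sum_comm]
  refine Finset.sum_congr rfl fun σ _ => ?_
  rw [← Finset.mul_sum]
  congr 1
  let ed : n ⊕ n → n := fun p => p.elim id id
  let H₀ : Finset n :=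
    Finset.univ.filter fun e => ¬ ∃ i, ed (σ (Sum.inl i)) = e ∧ ed (σ (Sum.inr i)) = e
  have hpartner : ∀ e i, ed (σ (Sum.inl i)) = e → ed (σ (Sum.inr i)) = e →
      ∀ p, ed (σ p) = e → p = Sum.inl i ∨ p = Sum.inr i := by
    intro e i h1 h2 p hp
    have hne : σ (Sum.inl i) ≠ σ (Sum.inr i) := fun h => by simpa using σ.injective h
    rcases eq_inl_or_inr_of_elim_eq h1 with h1 | h1 <;>
      rcases eq_inl_or_inr_of_elim_eq h2 with h2 | h2 <;>
      rcases eq_inl_or_inr_of_elim_eq hp with hp | hp <;>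
      first
        | exact absurd (h1.trans h2.symm) hne
        | exact Or.inl (σ.injective (hp.trans h1.symm))
        | exact Or.inr (σ.injective (hp.trans h2.symm))
  have hT : ∀ i, ed (σ (Sum.inl i)) = ed (σ (Sum.inr i)) →
      T (σ (Sum.inl i)) (σ (Sum.inr i)) = 0 := by
    intro i hi
    have hne : σ (Sum.inl i) ≠ σ (Sum.inr i) := fun h => by simpa using σ.injective h
    rcases ha : σ (Sum.inl i) with a | a <;> rcases hb : σ (Sum.inr i) with b | b <;>
      simp only [ha, hb, ed, Sum.elim_inl, Sum.elim_inr, id] at hi <;> subst hi <;>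
      first | exact h₁ _ | exact h₂ _ | exact absurd (ha.trans hb.symm) hne
  rw [Finset.sum_eq_single H₀]
  · refine Finset.prod_congr rfl fun i _ => ?_
    rw [Matrix.add_apply, mul_diagonal, diagonal_mul, mul_diagonal, diagonal_mul]
    by_cases h : ed (σ (Sum.inl i)) = ed (σ (Sum.inr i))
    · have hnot : ed (σ (Sum.inl i)) ∉ H₀ := by
        simp only [H₀, Finset.mem_filter, not_and, not_not]
        exact fun _ => ⟨i, rfl, h.symm⟩
      have hnot' : ed (σ (Sum.inr i)) ∉ H₀ := h ▸ hnot
      have hd : ∀ p, ed p ∉ H₀ → d H₀ p = 1 := by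
        rintro (p | p) hp
        · exact if_neg hp
        · rfl
      have hr : restrictPairs H₀ T (σ (Sum.inl i)) (σ (Sum.inr i)) =
          J n R (σ (Sum.inl i)) (σ (Sum.inr i)) := by
        simp only [restrictPairs, of_apply]
        rw [if_neg (fun hh => hnot hh.1), if_pos ⟨hnot, hnot'⟩]
      rw [hT i h, hr, hd _ hnot, hd _ hnot']
      simp
    · have hin : ed (σ (Sum.inl i)) ∈ H₀ := by
        simp only [H₀, Finset.mem_filter, Finset.mem_univ, true_and]
        rintro ⟨j, hj1, hj2⟩
        have := hpartner _ j hj1 hj2 (Sum.inl i) rfl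
        obtain rfl : i = j := by simpa using this
        exact h hj2.symm
      have hin' : ed (σ (Sum.inr i)) ∈ H₀ := by
        simp only [H₀, Finset.mem_filter, Finset.mem_univ, true_and]
        rintro ⟨j, hj1, hj2⟩
        have := hpartner _ j hj1 hj2 (Sum.inr i) rfl
        obtain rfl : i = j := by simpa using this
        exact h hj1
      have hd : ∀ p, ed p ∈ H₀ → d H₀ p = Sum.elim x 1 p := by
        rintro (p | p) hp
        · exact if_pos hp
        · rfl
      have hr : restrictPairs H₀ T (σ (Sum.inl i)) (σ (Sum.inr i)) =
          T (σ (Sum.inl i)) (σ (Sum.inr i)) := by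
        simp only [restrictPairs, of_apply]
        rw [if_pos ⟨hin, hin'⟩]
      rw [J_apply_of_ne h, hr, hd _ hin, hd _ hin', zero_add]
  · intro H _ hH
    obtain ⟨e, he⟩ : ∃ e, ¬ (e ∈ H ↔ e ∈ H₀) := by
      by_contra hcon
      push Not at hcon
      exact hH (Finset.ext hcon)
    suffices ∃ i, restrictPairs H T (σ (Sum.inl i)) (σ (Sum.inr i)) = 0 by
      obtain ⟨i, hi⟩ := this
      refine Finset.prod_eq_zero (Finset.mem_univ i) ?_
      rw [mul_diagonal, diagonal_mul, hi]
      simp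
    by_cases heH : e ∈ H
    · have : e ∉ H₀ := fun h => he ⟨fun _ => h, fun _ => heH⟩
      simp only [H₀, Finset.mem_filter, Finset.mem_univ, true_and, not_not] at this
      obtain ⟨i, h1, h2⟩ := this
      refine ⟨i, ?_⟩
      simp only [restrictPairs, of_apply]
      rw [if_pos ⟨Set.mem_of_eq_of_mem h1 heH, Set.mem_of_eq_of_mem h2 heH⟩,
        hT i (h1.trans h2.symm)]
    · have h0 : e ∈ H₀ := by
        by_contra h
        exact he ⟨fun h' => absurd h' heH, fun h' => absurd h' h⟩
      simp only [H₀, Finset.mem_filter, Finset.mem_univ, true_and, not_exists, not_and] at h0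
      obtain ⟨p, hp⟩ := σ.surjective (Sum.inl e)
      rcases p with i | i
      · refine ⟨i, ?_⟩
        have h1 : ed (σ (Sum.inl i)) = e := by rw [hp]; rfl
        have h2 := h0 i h1
        simp only [restrictPairs, of_apply]
        rw [if_neg (fun hh => heH (h1 ▸ hh.1)), J_apply_of_ne (fun hh => h2 (hh.symm.trans h1))]
        simp
      · refine ⟨i, ?_⟩
        have h1 : ed (σ (Sum.inr i)) = e := by rw [hp]; rfl
        have h2 : ed (σ (Sum.inl i)) ≠ ed (σ (Sum.inr i)) :=
          fun hh => h0 i (hh.trans h1) h1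
        simp only [restrictPairs, of_apply]
        rw [if_neg (fun hh => heH (h1 ▸ hh.2)), J_apply_of_ne h2]
        simp
  · exact fun h => absurd (Finset.mem_univ _) h

theorem pfSum_eq_zero_of_odd (A : Matrix (n ⊕ n) (n ⊕ n) R) (S : Finset (n ⊕ n))
    (hS : Odd S.card) (hA : ∀ p q, A p q ≠ 0 → (p ∈ S ↔ q ∈ S)) : pfSum A = 0 := by
  refine Finset.sum_eq_zero fun σ _ => ?_
  by_contra hne
  have hne' : ∀ i, A (σ (Sum.inl i)) (σ (Sum.inr i)) ≠ 0 := fun i h =>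
    right_ne_zero_of_mul hne (Finset.prod_eq_zero (Finset.mem_univ i) h)
  have hcard : S.card = ∑ p : n ⊕ n, if σ p ∈ S then 1 else 0 := by
    rw [Equiv.sum_comp σ (fun p => if p ∈ S then 1 else 0)]
    simp
  rw [Fintype.sum_sum_type, ← Finset.sum_add_distrib] at hcard
  have : Even S.card := by
    rw [hcard]
    refine Finset.even_sum _ fun i _ => ?_
    simp only [hA _ _ (hne' i)]
    exact Even.add_self _
  exact (Nat.not_even_iff_odd.2 hS) this

end Expansion

section Tournament

open Matrix Equiv

/-- The enumeration `inl 0, inr 0, inl 1, inr 1, …` of `Fin m ⊕ Fin m`. -/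
def pairEquiv (m : ℕ) : Fin m ⊕ Fin m ≃ Fin (m * 2) :=
  ((Equiv.boolProdEquivSum (Fin m)).symm.trans
    ((finTwoEquiv.symm.prodCongr (Equiv.refl _)).trans (Equiv.prodComm _ _))).trans finProdFinEquiv

theorem pairEquiv_inl {m : ℕ} (i : Fin m) : (pairEquiv m (Sum.inl i) : ℕ) = 2 * i := by
  simp [pairEquiv, finProdFinEquiv, Equiv.boolProdEquivSum, finTwoEquiv]

theorem pairEquiv_inr {m : ℕ} (i : Fin m) : (pairEquiv m (Sum.inr i) : ℕ) = 2 * i + 1 := by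
  simp [pairEquiv, finProdFinEquiv, Equiv.boolProdEquivSum, finTwoEquiv, add_comm]

variable {m : ℕ} {K : Type*}

theorem prod_Iio_pairEquiv [CommRing K] (g : Fin m ⊕ Fin m → Fin m ⊕ Fin m → K) :
    ∏ k, ∏ l ∈ Finset.Iio k, g ((pairEquiv m).symm l) ((pairEquiv m).symm k) =
      (∏ i, g (Sum.inl i) (Sum.inr i)) * ∏ j, ∏ i ∈ Finset.Iio j,
        (g (Sum.inl i) (Sum.inl j) * g (Sum.inl i) (Sum.inr j) *
          (g (Sum.inr i) (Sum.inl j) * g (Sum.inr i) (Sum.inr j))) := by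
  have hIio : ∀ {N : ℕ} (k : Fin N) (h : Fin N → K),
      ∏ l ∈ Finset.Iio k, h l = ∏ l, if l < k then h l else 1 := by
    intro N k h
    rw [← Finset.prod_filter]
    exact Finset.prod_congr (by ext; simp) fun _ _ => rfl
  have h1 : ∏ k, ∏ l ∈ Finset.Iio k, g ((pairEquiv m).symm l) ((pairEquiv m).symm k) =
      ∏ p, ∏ q, if pairEquiv m q < pairEquiv m p then g q p else 1 := by
    refine ((pairEquiv m).prod_comp _).symm.trans (Finset.prod_congr rfl fun p _ => ?_)
    rw [hIio]
    refine ((pairEquiv m).prod_comp _).symm.trans (Finset.prod_congr rfl fun q _ => ?_)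
    simp only [Equiv.symm_apply_apply]
  rw [h1]
  simp only [hIio, Fintype.prod_sum_type, Fin.lt_def, pairEquiv_inl, pairEquiv_inr,
    ← Finset.prod_mul_distrib]
  refine Finset.prod_congr rfl fun j _ => ?_
  have hj : g (Sum.inl j) (Sum.inr j) =
      ∏ i, (if i = j then g (Sum.inl i) (Sum.inr i) else (1 : K)) := by simp
  rw [hj]
  simp only [← Finset.prod_mul_distrib]
  refine Finset.prod_congr rfl fun i _ => ?_
  rcases lt_trichotomy i j with h | rfl | h
  · have h' := h
    rw [Fin.lt_def] at h'
    rw [if_pos (by omega), if_pos (by omega), if_pos (by omega), if_pos (by omega),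
      if_neg h.ne, if_pos h']
    ring
  · simp
  · have h' := h
    rw [Fin.lt_def] at h'
    rw [if_neg (by omega), if_neg (by omega), if_neg (by omega), if_neg (by omega),
      if_neg h.ne', if_neg (by omega)]
    ring

theorem prod_Iio_mul_swap [CommRing K] (W : Fin m → Fin m → K) (hW : ∀ i, W i i = 1) :
    ∏ j, ∏ i ∈ Finset.Iio j, (W i j * W j i) = ∏ i, ∏ j, W i j := by
  have hIio : ∀ (k : Fin m) (h : Fin m → K),
      ∏ l ∈ Finset.Iio k, h l = ∏ l, if l < k then h l else 1 := by
    intro k h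
    rw [← Finset.prod_filter]
    exact Finset.prod_congr (by ext; simp) fun _ _ => rfl
  have h1 : ∀ i j, W i j = (if i < j then W i j else 1) * (if j < i then W i j else 1) := by
    intro i j
    rcases lt_trichotomy i j with h | rfl | h
    · simp [h, h.not_gt]
    · simp [hW]
    · simp [h, h.not_gt]
  have h2 : ∏ i, ∏ j, W i j =
      (∏ i, ∏ j, if i < j then W i j else 1) * ∏ i, ∏ j, if j < i then W i j else 1 := by
    simp only [← Finset.prod_mul_distrib, ← h1]
  rw [h2, Finset.prod_comm, ← Finset.prod_mul_distrib]
  refine Finset.prod_congr rfl fun j _ => ?_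
  rw [hIio, ← Finset.prod_mul_distrib]
  refine Finset.prod_congr rfl fun i _ => ?_
  split_ifs <;> simp

/-- The sign comparing `a` and `b`. -/
def orderSign (K : Type*) [Ring K] {κ : Type*} [LinearOrder κ] (a b : κ) : K :=
  if a < b then 1 else if b < a then -1 else 0

section orderSign

variable [Ring K] {κ : Type*} [LinearOrder κ] {a b : κ}

theorem orderSign_of_lt (h : a < b) : orderSign K a b = 1 := if_pos h

theorem orderSign_of_gt (h : b < a) : orderSign K a b = -1 := by
  rw [orderSign, if_neg h.not_gt, if_pos h]

theorem orderSign_self : orderSign K a a = 0 := by simp [orderSign]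

theorem orderSign_swap : orderSign K a b = -orderSign K b a := by
  rcases lt_trichotomy a b with h | rfl | h
  · rw [orderSign_of_lt h, orderSign_of_gt h, neg_neg]
  · simp [orderSign_self]
  · rw [orderSign_of_lt h, orderSign_of_gt h]

end orderSign

theorem apply_pair_eq_of_even_fibers {β : Type*} [LinearOrder β] (b : Fin m ⊕ Fin m → β)
    (o : Fin (m * 2) ≃ Fin m ⊕ Fin m) (hb : Monotone (b ∘ o))
    (heven : ∀ c, Even (Finset.univ.filter fun p => b p = c).card) (i : Fin m) :
    b (o (pairEquiv m (Sum.inl i))) = b (o (pairEquiv m (Sum.inr i))) := by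
  set k := pairEquiv m (Sum.inl i) with hk
  set l := pairEquiv m (Sum.inr i) with hl
  have hkv : (k : ℕ) = 2 * i := pairEquiv_inl i
  have hlv : (l : ℕ) = 2 * i + 1 := pairEquiv_inr i
  have hkl : k ≤ l := by rw [Fin.le_def]; omega
  by_contra hne
  have hlt : b (o k) < b (o l) := lt_of_le_of_ne (hb hkl) hne
  let F := Finset.univ.filter fun p => b p ≤ b (o k)
  have hF : F = (Finset.Iic k).map o.toEmbedding := by
    ext p
    obtain ⟨j, rfl⟩ := o.surjective p
    simp only [F, Finset.mem_filter, Finset.mem_univ, true_and, Finset.mem_map_equiv,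
      Equiv.symm_apply_apply, Finset.mem_Iic]
    constructor
    · intro h
      by_contra hj
      have hlj : l ≤ j := by rw [Fin.le_def] at hj ⊢; omega
      exact absurd (hb hlj) (not_le.2 (lt_of_le_of_lt h hlt))
    · exact fun h => hb h
  have hcard : F.card = 2 * i + 1 := by
    rw [hF, Finset.card_map, Fin.card_Iic, hkv]
  have hFeven : Even F.card := by
    rw [Finset.card_eq_sum_card_image b F]
    refine Finset.even_sum _ fun c hc => ?_
    obtain ⟨p, hp, rfl⟩ := Finset.mem_image.1 hc
    have hp' : F.filter (fun q => b q = b p) = Finset.univ.filter fun q => b q = b p := by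
      ext q
      simp only [F, Finset.mem_filter, Finset.mem_univ, true_and] at hp ⊢
      exact ⟨fun h => h.2, fun h => ⟨h ▸ hp, h⟩⟩
    rw [hp']
    exact heven (b p)
  rw [hcard] at hFeven
  exact Nat.not_even_two_mul_add_one _ hFeven

theorem exists_equiv_strictMono_comp {α κ : Type*} [Fintype α] [LinearOrder κ] (r : α → κ)
    (hr : Function.Injective r) {k : ℕ} (h : Fintype.card α = k) :
    ∃ o : Fin k ≃ α, StrictMono (r ∘ o) := by
  let _ : LinearOrder α := LinearOrder.lift' r hr
  let o := Fintype.orderIsoFinOfCardEq α h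
  exact ⟨o.toEquiv, o.strictMono⟩

/-- The Pfaffian of a block diagonal matrix whose blocks have even size and are the signs of a
linear order, in terms of the signs attached to the pairs of pairs of indices. -/
theorem pfSum_blockTournament [Field K] [CharZero K] {κ β : Type*} [LinearOrder κ] [LinearOrder β]
    (r : Fin m ⊕ Fin m → κ) (hr : Function.Injective r) (b : Fin m ⊕ Fin m → β)
    (hb : ∀ p q, b p < b q → r p < r q)
    (heven : ∀ c, Even (Finset.univ.filter fun p => b p = c).card)
    (hpair : ∀ i, r (Sum.inl i) < r (Sum.inr i)) (W : Fin m → Fin m → K)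
    (hWi : ∀ i, W i i = 1) (hWprod : ∏ i, ∏ j, W i j = 1)
    (hW : ∀ i j, i ≠ j →
      orderSign K (r (Sum.inl i)) (r (Sum.inl j)) * orderSign K (r (Sum.inl i)) (r (Sum.inr j)) *
        (orderSign K (r (Sum.inr i)) (r (Sum.inl j)) *
          orderSign K (r (Sum.inr i)) (r (Sum.inr j))) = W i j * W j i) :
    pfSum (of fun p q => if b p = b q then -orderSign K (r p) (r q) else 0) =
      pfSum (J (Fin m) K) := by
  obtain ⟨o, ho⟩ := exists_equiv_strictMono_comp r hr
    (show Fintype.card (Fin m ⊕ Fin m) = m * 2 by simp [mul_two])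
  let π : Perm (Fin m ⊕ Fin m) := (pairEquiv m).trans o
  have hbo : Monotone (b ∘ o) := by
    intro k l hkl
    by_contra h
    exact absurd (hb _ _ (not_le.1 h)) (not_lt.2 (ho.monotone hkl))
  have hsign : ((Perm.sign π : ℤ) : K) = 1 := by
    let σ : Perm (Fin (m * 2)) := ((pairEquiv m).symm.trans π).trans (pairEquiv m)
    have hσ : Perm.sign σ = Perm.sign π := Perm.sign_symm_trans_trans _ _
    let f : Fin (m * 2) → Fin (m * 2) → K := fun k l =>
      orderSign K (r ((pairEquiv m).symm k)) (r ((pairEquiv m).symm l))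
    have h := σ.prod_Iio_comp_eq_sign_mul_prod (f := f) (fun _ _ => orderSign_swap)
    have hleft : ∏ j, ∏ i ∈ Finset.Iio j, f (σ i) (σ j) = 1 := by
      refine Finset.prod_eq_one fun j _ => Finset.prod_eq_one fun i hi => ?_
      have hij := ho (Finset.mem_Iio.1 hi)
      simpa [f, σ, π] using orderSign_of_lt (K := K) hij
    have hright : ∏ j, ∏ i ∈ Finset.Iio j, f i j = 1 := by
      simp only [f]
      rw [prod_Iio_pairEquiv (fun p q => orderSign K (r p) (r q)),
        Finset.prod_eq_one fun i _ => orderSign_of_lt (hpair i), one_mul, ← hWprod,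
        ← prod_Iio_mul_swap W hWi]
      exact Finset.prod_congr rfl fun j _ => Finset.prod_congr rfl fun i hi =>
        hW i j (Finset.mem_Iio.1 hi).ne
    rw [hleft, hright, mul_one, hσ] at h
    exact h.symm
  have hrπ : ∀ p q, pairEquiv m p < pairEquiv m q → r (π p) < r (π q) := fun p q h => ho h
  let U : Matrix (Fin m) (Fin m) K := of fun i j =>
    if b (π (Sum.inl i)) = b (π (Sum.inl j)) then -orderSign K i j else 0
  have hU : Uᵀ = -U := by
    ext i j
    simp only [U, transpose_apply, of_apply, Matrix.neg_apply, eq_comm (a := b (π (Sum.inl j)))]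
    split_ifs
    · rw [orderSign_swap]
    · simp
  have hbπ : ∀ i, b (π (Sum.inr i)) = b (π (Sum.inl i)) := fun i =>
    (apply_pair_eq_of_even_fibers b o hbo heven i).symm
  have hmat : (of fun p q => if b p = b q then -orderSign K (r p) (r q) else 0).submatrix π π =
      J (Fin m) K + fromBlocks U U U U := by
    have hs : ∀ p q : Fin m ⊕ Fin m, p.elim id id ≠ q.elim id id →
        orderSign K (r (π p)) (r (π q)) = orderSign K (p.elim id id) (q.elim id id) := by
      have hlt : ∀ p q : Fin m ⊕ Fin m, p.elim id id < q.elim id id →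
          r (π p) < r (π q) := by
        intro p q hpq
        apply hrπ
        rw [Fin.lt_def]
        rw [Fin.lt_def] at hpq
        rcases p with p | p <;> rcases q with q | q <;>
          simp only [pairEquiv_inl, pairEquiv_inr, Sum.elim_inl, Sum.elim_inr, id] at hpq ⊢ <;>
          omega
      intro p q hpq
      rcases lt_or_gt_of_ne hpq with h | h
      · rw [orderSign_of_lt h, orderSign_of_lt (hlt p q h)]
      · rw [orderSign_of_gt h, orderSign_of_gt (hlt q p h)]
    have hd : ∀ i, r (π (Sum.inl i)) < r (π (Sum.inr i)) := fun i => hrπ _ _ (by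
      rw [Fin.lt_def, pairEquiv_inl, pairEquiv_inr]; omega)
    ext p q
    by_cases hpq : p.elim id id = q.elim id id
    · rcases p with p | p <;> rcases q with q | q <;> simp only [Sum.elim_inl, Sum.elim_inr, id]
        at hpq <;> subst hpq <;>
        simp [J, U, hbπ, orderSign_self, orderSign_of_lt (hd _), orderSign_of_gt (hd _)]
    · have h0 := hs p q hpq
      rw [Matrix.add_apply, J_apply_of_ne hpq, zero_add]
      rcases p with p | p <;> rcases q with q | q <;>
        simp only [submatrix_apply, of_apply, h0, hbπ] <;> rfl
  have h := pfSum_submatrix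
    (of fun p q => if b p = b q then -orderSign K (r p) (r q) else 0) π
  rw [hmat, pfSum_J_add_fromBlocks U hU, hsign, one_mul] at h
  exact h.symm

end Tournament

/-- A finite family of nonvertical segments in the plane, given by their left and right endpoints,
which pairwise intersect only at common endpoints. -/
structure SegmentFamily (V : Type*) (m : ℕ) where
  X : V → ℝ
  Y : V → ℝ
  X_injective : Function.Injective X
  L : Fin m → V
  R : Fin m → V
  lt : ∀ e, X (L e) < X (R e)
  meet : ∀ e f, e ≠ f → ∀ x, X (L e) ≤ x → x ≤ X (R e) → X (L f) ≤ x → x ≤ X (R f) →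
    Y (L e) + (Y (R e) - Y (L e)) / (X (R e) - X (L e)) * (x - X (L e)) =
      Y (L f) + (Y (R f) - Y (L f)) / (X (R f) - X (L f)) * (x - X (L f)) →
    ∃ w, x = X w ∧ (w = L e ∨ w = R e) ∧ (w = L f ∨ w = R f)

namespace SegmentFamily

open Matrix

variable {V : Type*} {m : ℕ} (S : SegmentFamily V m)

theorem L_ne_R (e : Fin m) : S.L e ≠ S.R e := fun h => (S.lt e).ne (congrArg S.X h)

/-- The slope of a segment. -/
noncomputable def slope (e : Fin m) : ℝ :=
  (S.Y (S.R e) - S.Y (S.L e)) / (S.X (S.R e) - S.X (S.L e))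

/-- The height of the line through a segment. -/
noncomputable def height (e : Fin m) (x : ℝ) : ℝ := S.Y (S.L e) + S.slope e * (x - S.X (S.L e))

theorem height_L (e : Fin m) : S.height e (S.X (S.L e)) = S.Y (S.L e) := by simp [height]

theorem height_R (e : Fin m) : S.height e (S.X (S.R e)) = S.Y (S.R e) := by
  have := sub_ne_zero.2 (S.lt e).ne'
  rw [height, slope, div_mul_cancel₀ _ this]
  ring

theorem height_sub_height (e : Fin m) (x y : ℝ) :
    S.height e x - S.height e y = S.slope e * (x - y) := by
  simp only [height]
  ring

theorem height_ne_height {e f : Fin m} (hef : e ≠ f) {x : ℝ} (h₁ : S.X (S.L e) ≤ x)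
    (h₂ : x ≤ S.X (S.R e)) (h₃ : S.X (S.L f) ≤ x) (h₄ : x ≤ S.X (S.R f))
    (h : ¬ ((x = S.X (S.L e) ∨ x = S.X (S.R e)) ∧ (x = S.X (S.L f) ∨ x = S.X (S.R f)))) :
    S.height e x ≠ S.height f x := by
  intro h₀
  obtain ⟨w, rfl, he, hf⟩ := S.meet e f hef x h₁ h₂ h₃ h₄ h₀
  exact h ⟨he.imp (congrArg _) (congrArg _), hf.imp (congrArg _) (congrArg _)⟩

theorem height_lt_height_iff {e f : Fin m} {x y : ℝ} (hxy : x ≤ y)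
    (h : ∀ z, x ≤ z → z ≤ y → S.height e z ≠ S.height f z) :
    S.height e x < S.height f x ↔ S.height e y < S.height f y := by
  have hc : ContinuousOn (fun z => S.height e z - S.height f z) (Set.Icc x y) := by
    unfold height
    fun_prop
  constructor
  · intro hx
    by_contra hy
    obtain ⟨z, hz, hz0⟩ := intermediate_value_Icc hxy hc
      (show (0 : ℝ) ∈ Set.Icc _ _ from ⟨by linarith, by linarith⟩)
    exact h z hz.1 hz.2 (sub_eq_zero.1 hz0)
  · intro hy
    by_contra hx
    obtain ⟨z, hz, hz0⟩ := intermediate_value_Icc' hxy hc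
      (show (0 : ℝ) ∈ Set.Icc _ _ from ⟨by linarith, by linarith⟩)
    exact h z hz.1 hz.2 (sub_eq_zero.1 hz0)

theorem slope_ne_of_L_eq {e f : Fin m} (hef : e ≠ f) (h : S.L e = S.L f) :
    S.slope e ≠ S.slope f := by
  intro hs
  have he := S.lt e
  have hf := S.lt f
  rw [← h] at hf
  obtain ⟨x, hx, hx'⟩ := exists_between (lt_min he hf)
  obtain ⟨hxe, hxf⟩ := lt_min_iff.1 hx'
  refine S.height_ne_height hef hx.le hxe.le (h ▸ hx.le) hxf.le ?_ ?_
  · rintro ⟨h₁ | h₁, -⟩ <;> linarith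
  · rw [height, height, hs, h]

theorem slope_ne_of_R_eq {e f : Fin m} (hef : e ≠ f) (h : S.R e = S.R f) :
    S.slope e ≠ S.slope f := by
  intro hs
  have he := S.lt e
  have hf := S.lt f
  rw [← h] at hf
  obtain ⟨x, hx', hx⟩ := exists_between (max_lt he hf)
  obtain ⟨hxe, hxf⟩ := max_lt_iff.1 hx'
  refine S.height_ne_height hef hxe.le hx.le hxf.le (h ▸ hx.le) ?_ ?_
  · rintro ⟨h₁ | h₁, -⟩ <;> linarith
  · have h₁ := S.height_sub_height e x (S.X (S.R e))
    have h₂ := S.height_sub_height f x (S.X (S.R f))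
    rw [S.height_R] at h₁ h₂
    rw [hs, h] at h₁
    linarith

/-- The tail of a directed segment; `inl` is directed to the right, `inr` to the left. -/
def tail : Fin m ⊕ Fin m → V := Sum.elim S.L S.R

/-- A key sorting the directed segments by tail, and those with the same tail clockwise or
counterclockwise, first those directed to the left and then those directed to the right. -/
noncomputable def key : Fin m ⊕ Fin m → ℝ ×ₗ ℕ ×ₗ ℝ :=
  Sum.elim (fun e => toLex (S.X (S.L e), toLex (1, S.slope e)))
    (fun e => toLex (S.X (S.R e), toLex (0, S.slope e)))

theorem key_lt_key_of_X_lt {p q : Fin m ⊕ Fin m} (h : S.X (S.tail p) < S.X (S.tail q)) :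
    S.key p < S.key q := by
  rcases p with p | p <;> rcases q with q | q <;>
    exact Prod.Lex.toLex_lt_toLex.2 (Or.inl h)

theorem key_inr_lt_key_inl {e f : Fin m} (h : S.R e = S.L f) :
    S.key (Sum.inr e) < S.key (Sum.inl f) := by
  simp [key, Prod.Lex.toLex_lt_toLex, h]

theorem key_inl_lt_key_inl {e f : Fin m} (h : S.L e = S.L f) :
    S.key (Sum.inl e) < S.key (Sum.inl f) ↔ S.slope e < S.slope f := by
  simp [key, Prod.Lex.toLex_lt_toLex, h]

theorem key_inr_lt_key_inr {e f : Fin m} (h : S.R e = S.R f) :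
    S.key (Sum.inr e) < S.key (Sum.inr f) ↔ S.slope e < S.slope f := by
  simp [key, Prod.Lex.toLex_lt_toLex, h]

theorem key_injective : Function.Injective S.key := by
  intro p q h
  rcases p with e | e <;> rcases q with f | f <;>
    simp only [key, Sum.elim_inl, Sum.elim_inr, EmbeddingLike.apply_eq_iff_eq, Prod.mk.injEq,
      one_ne_zero, zero_ne_one, false_and, and_false, true_and] at h
  · by_contra hef
    exact S.slope_ne_of_L_eq (fun hef' => hef (congrArg _ hef')) (S.X_injective h.1) h.2
  · by_contra hef
    exact S.slope_ne_of_R_eq (fun hef' => hef (congrArg _ hef')) (S.X_injective h.1) h.2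

variable {K : Type*} [Field K]

/-- `-1` if the segment passes strictly above the vertex, and `1` otherwise. -/
noncomputable def aboveSign (K : Type*) [Field K] (v : V) (f : Fin m) : K :=
  if S.X (S.L f) < S.X v ∧ S.X v < S.X (S.R f) ∧ S.Y v < S.height f (S.X v) then -1 else 1

theorem aboveSign_of_le_L {v : V} {f : Fin m} (h : S.X v ≤ S.X (S.L f)) :
    S.aboveSign K v f = 1 := if_neg fun h' => h'.1.not_ge h

theorem aboveSign_of_R_le {v : V} {f : Fin m} (h : S.X (S.R f) ≤ S.X v) :
    S.aboveSign K v f = 1 := if_neg fun h' => h'.2.1.not_ge h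

theorem aboveSign_of_mem {v : V} {f : Fin m} (h : S.X (S.L f) < S.X v) (h' : S.X v < S.X (S.R f)) :
    S.aboveSign K v f = if S.Y v < S.height f (S.X v) then -1 else 1 := by
  simp [aboveSign, h, h']

theorem aboveSign_mul_self (v : V) (f : Fin m) : S.aboveSign K v f * S.aboveSign K v f = 1 := by
  unfold aboveSign
  split_ifs <;> simp

/-- The product of `aboveSign` over the endpoints of the first segment. -/
noncomputable def edgeSign (K : Type*) [Field K] (e f : Fin m) : K :=
  S.aboveSign K (S.L e) f * S.aboveSign K (S.R e) f

theorem edgeSign_self (e : Fin m) : S.edgeSign K e e = 1 := by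
  rw [edgeSign, S.aboveSign_of_le_L le_rfl, S.aboveSign_of_R_le le_rfl, one_mul]

/-- The product of the signs comparing the two half-edges of `e` with those of `f`. -/
noncomputable def crossSign (K : Type*) [Field K] (e f : Fin m) : K :=
  orderSign K (S.key (Sum.inl e)) (S.key (Sum.inl f)) *
      orderSign K (S.key (Sum.inl e)) (S.key (Sum.inr f)) *
    (orderSign K (S.key (Sum.inr e)) (S.key (Sum.inl f)) *
      orderSign K (S.key (Sum.inr e)) (S.key (Sum.inr f)))

theorem crossSign_comm (e f : Fin m) : S.crossSign K e f = S.crossSign K f e := by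
  unfold crossSign
  rw [orderSign_swap (a := S.key (Sum.inl e)) (b := S.key (Sum.inl f)),
    orderSign_swap (a := S.key (Sum.inl e)) (b := S.key (Sum.inr f)),
    orderSign_swap (a := S.key (Sum.inr e)) (b := S.key (Sum.inl f)),
    orderSign_swap (a := S.key (Sum.inr e)) (b := S.key (Sum.inr f))]
  ring

theorem crossSign_eq_of_L_lt {e f : Fin m} (hef : e ≠ f) (h : S.X (S.L e) < S.X (S.L f)) :
    S.crossSign K e f = S.edgeSign K e f * S.edgeSign K f e := by
  have he := S.lt e
  have hf := S.lt f
  have h₁ : orderSign K (S.key (Sum.inl e)) (S.key (Sum.inl f)) = 1 :=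
    orderSign_of_lt (S.key_lt_key_of_X_lt h)
  have h₂ : orderSign K (S.key (Sum.inl e)) (S.key (Sum.inr f)) = 1 :=
    orderSign_of_lt (S.key_lt_key_of_X_lt (h.trans hf))
  rw [crossSign, edgeSign, edgeSign, h₁, h₂, S.aboveSign_of_le_L h.le, one_mul, one_mul, one_mul]
  rcases le_or_gt (S.X (S.R e)) (S.X (S.L f)) with hb | hb
  · have h₃ : orderSign K (S.key (Sum.inr e)) (S.key (Sum.inl f)) = 1 := by
      rcases hb.lt_or_eq with hb' | hb'
      · exact orderSign_of_lt (S.key_lt_key_of_X_lt hb')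
      · exact orderSign_of_lt (S.key_inr_lt_key_inl (S.X_injective hb'))
    rw [h₃, orderSign_of_lt (S.key_lt_key_of_X_lt (p := Sum.inr e) (q := Sum.inr f)
      (hb.trans_lt hf)), S.aboveSign_of_le_L hb,
      S.aboveSign_of_R_le hb, S.aboveSign_of_R_le (hb.trans hf.le)]
    ring
  rw [orderSign_of_gt (S.key_lt_key_of_X_lt (p := Sum.inl f) (q := Sum.inr e) hb),
    S.aboveSign_of_mem h hb]
  rcases lt_trichotomy (S.X (S.R e)) (S.X (S.R f)) with hbd | hbd | hbd
  · rw [orderSign_of_lt (S.key_lt_key_of_X_lt (p := Sum.inr e) (q := Sum.inr f) hbd),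
      S.aboveSign_of_mem hb hbd,
      S.aboveSign_of_R_le hbd.le]
    have hne : ∀ z, S.X (S.L f) ≤ z → z ≤ S.X (S.R e) → S.height e z ≠ S.height f z := by
      intro z hz hz'
      refine S.height_ne_height hef (h.le.trans hz) hz' hz (hz'.trans hbd.le) ?_
      rintro ⟨h₁ | h₁, h₂ | h₂⟩ <;> linarith
    have hiff := S.height_lt_height_iff hb.le hne
    have hne' := hne _ le_rfl hb.le
    rw [S.height_L] at hiff hne'
    rw [S.height_R] at hiff
    simp only [← hiff]
    rcases lt_or_gt_of_ne hne' with h₃ | h₃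
    · rw [if_pos h₃, if_neg h₃.not_gt]; ring
    · rw [if_pos h₃, if_neg h₃.not_gt]; ring
  · have hR : S.R e = S.R f := S.X_injective hbd
    rw [S.aboveSign_of_R_le hbd.ge, S.aboveSign_of_R_le hbd.le]
    have h₄ := S.height_sub_height e (S.X (S.L f)) (S.X (S.R e))
    have h₅ := S.height_sub_height f (S.X (S.L f)) (S.X (S.R f))
    rw [S.height_R] at h₄ h₅
    rw [S.height_L] at h₅
    rw [hR] at h₄
    have h₆ : S.height e (S.X (S.L f)) - S.Y (S.L f) =
        (S.slope f - S.slope e) * (S.X (S.R f) - S.X (S.L f)) := by linarith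
    rcases lt_or_gt_of_ne (S.slope_ne_of_R_eq hef hR) with hs | hs
    · rw [orderSign_of_lt ((S.key_inr_lt_key_inr hR).2 hs), if_pos (by nlinarith)]
      ring
    · rw [orderSign_of_gt ((S.key_inr_lt_key_inr hR.symm).2 hs), if_neg (by nlinarith)]
      ring
  · rw [orderSign_of_gt (S.key_lt_key_of_X_lt (p := Sum.inr f) (q := Sum.inr e) hbd),
      S.aboveSign_of_R_le hbd.le, S.aboveSign_of_mem (h.trans hf) hbd]
    have hne : ∀ z, S.X (S.L f) ≤ z → z ≤ S.X (S.R f) → S.height f z ≠ S.height e z := by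
      intro z hz hz'
      refine S.height_ne_height hef.symm hz hz' (h.le.trans hz) (hz'.trans hbd.le) ?_
      rintro ⟨h₁ | h₁, h₂ | h₂⟩ <;> linarith
    have hiff := S.height_lt_height_iff hf.le hne
    rw [S.height_L, S.height_R] at hiff
    simp only [hiff]
    split_ifs <;> ring

theorem crossSign_eq_of_R_lt {e f : Fin m} (hef : e ≠ f) (h : S.L e = S.L f)
    (h' : S.X (S.R e) < S.X (S.R f)) :
    S.crossSign K e f = S.edgeSign K e f * S.edgeSign K f e := by
  have he := S.lt e
  have hf := S.lt f
  have hX : S.X (S.L e) = S.X (S.L f) := congrArg S.X h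
  rw [crossSign, edgeSign, edgeSign,
    orderSign_of_lt (S.key_lt_key_of_X_lt (p := Sum.inr e) (q := Sum.inr f) h'),
    orderSign_of_lt (S.key_lt_key_of_X_lt (p := Sum.inl e) (q := Sum.inr f) (he.trans h')),
    orderSign_of_gt (S.key_lt_key_of_X_lt (p := Sum.inl f) (q := Sum.inr e) (hX ▸ he)),
    S.aboveSign_of_le_L hX.le, S.aboveSign_of_le_L hX.ge, S.aboveSign_of_R_le h'.le,
    S.aboveSign_of_mem (hX ▸ he) h']
  have h₄ := S.height_sub_height e (S.X (S.R e)) (S.X (S.L e))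
  have h₅ := S.height_sub_height f (S.X (S.R e)) (S.X (S.L f))
  rw [S.height_L] at h₄ h₅
  rw [S.height_R, h] at h₄
  have h₆ : S.height f (S.X (S.R e)) - S.Y (S.R e) =
      (S.slope f - S.slope e) * (S.X (S.R e) - S.X (S.L f)) := by linarith
  rcases lt_or_gt_of_ne (S.slope_ne_of_L_eq hef h) with hs | hs
  · rw [orderSign_of_lt ((S.key_inl_lt_key_inl h).2 hs), if_pos (by nlinarith)]
    ring
  · rw [orderSign_of_gt ((S.key_inl_lt_key_inl h.symm).2 hs), if_neg (by nlinarith)]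
    ring

theorem crossSign_eq {e f : Fin m} (hef : e ≠ f) :
    S.crossSign K e f = S.edgeSign K e f * S.edgeSign K f e := by
  rcases lt_trichotomy (S.X (S.L e)) (S.X (S.L f)) with h | h | h
  · exact S.crossSign_eq_of_L_lt hef h
  · have hL := S.X_injective h
    rcases lt_trichotomy (S.X (S.R e)) (S.X (S.R f)) with h' | h' | h'
    · exact S.crossSign_eq_of_R_lt hef hL h'
    · refine absurd ?_ (S.slope_ne_of_L_eq hef hL)
      rw [slope, slope, hL, S.X_injective h']
    · rw [crossSign_comm, S.crossSign_eq_of_R_lt hef.symm hL.symm h', mul_comm]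
  · rw [crossSign_comm, S.crossSign_eq_of_L_lt hef.symm h, mul_comm]

end SegmentFamily

namespace SegmentFamily

open Matrix

variable {V : Type*} [DecidableEq V] {m : ℕ} (S : SegmentFamily V m) {K : Type*} [Field K]

/-- The directed segments of a subfamily starting at a vertex. -/
def outgoing (H : Finset (Fin m)) (v : V) : Finset (Fin m ⊕ Fin m) :=
  Finset.univ.filter fun p => p.elim id id ∈ H ∧ S.tail p = v

theorem mem_outgoing {H : Finset (Fin m)} {v : V} {p : Fin m ⊕ Fin m} :
    p ∈ S.outgoing H v ↔ p.elim id id ∈ H ∧ S.tail p = v := by simp [outgoing]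

/-- The signs comparing directed segments with the same tail. -/
noncomputable def tailMatrix (K : Type*) [Field K] : Matrix (Fin m ⊕ Fin m) (Fin m ⊕ Fin m) K :=
  of fun p q => if S.tail p = S.tail q then -orderSign K (S.key p) (S.key q) else 0

theorem tailMatrix_transpose : (S.tailMatrix K)ᵀ = -S.tailMatrix K := by
  ext p q
  simp only [tailMatrix, transpose_apply, of_apply, Matrix.neg_apply,
    eq_comm (a := S.tail q)]
  split_ifs
  · rw [orderSign_swap]
  · simp

theorem tailMatrix_inl_inr (e : Fin m) : S.tailMatrix K (Sum.inl e) (Sum.inr e) = 0 :=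
  if_neg (S.L_ne_R e)

theorem tailMatrix_inr_inl (e : Fin m) : S.tailMatrix K (Sum.inr e) (Sum.inl e) = 0 :=
  if_neg (S.L_ne_R e).symm

theorem prod_edgeSign (H : Finset (Fin m)) (hH : ∀ v, Even (S.outgoing H v).card) :
    ∏ e, ∏ f, (if e ∈ H ∧ f ∈ H then S.edgeSign K e f else 1) = 1 := by
  rw [Finset.prod_comm]
  refine Finset.prod_eq_one fun f _ => ?_
  by_cases hf : f ∈ H
  swap
  · simp [hf]
  have h₁ : ∏ e, (if e ∈ H ∧ f ∈ H then S.edgeSign K e f else 1) =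
      ∏ p ∈ Finset.univ.filter (fun p : Fin m ⊕ Fin m => p.elim id id ∈ H),
        S.aboveSign K (S.tail p) f := by
    rw [Finset.prod_filter, Fintype.prod_sum_type, ← Finset.prod_mul_distrib]
    refine Finset.prod_congr rfl fun e _ => ?_
    by_cases he : e ∈ H <;> simp [he, hf, edgeSign, tail]
  rw [h₁, Finset.prod_comp (fun v => S.aboveSign K v f) S.tail]
  refine Finset.prod_eq_one fun v _ => ?_
  have h₂ : (Finset.univ.filter (fun p : Fin m ⊕ Fin m => p.elim id id ∈ H)).filter
      (fun p => S.tail p = v) = S.outgoing H v := by rw [Finset.filter_filter]; rfl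
  obtain ⟨k, hk⟩ := hH v
  rw [h₂, hk, pow_add, ← mul_pow, S.aboveSign_mul_self, one_pow]

theorem pfSum_restrictPairs_of_odd (H : Finset (Fin m)) {v : V}
    (hv : Odd (S.outgoing H v).card) : pfSum (restrictPairs H (S.tailMatrix K)) = 0 := by
  refine pfSum_eq_zero_of_odd _ (S.outgoing H v) hv fun p q hpq => ?_
  rw [mem_outgoing, mem_outgoing]
  rw [restrictPairs, of_apply] at hpq
  split_ifs at hpq with h₁ h₂
  · simp only [tailMatrix, of_apply, ne_eq, ite_eq_right_iff, Classical.not_imp] at hpq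
    simp [h₁, hpq.1]
  · simp [h₂]
  · exact absurd rfl hpq

/-- `0` for a member of the subfamily; otherwise a positive number identifying the segment. -/
def block (H : Finset (Fin m)) (p : Fin m ⊕ Fin m) : ℕ :=
  if p.elim id id ∈ H then 0 else (p.elim id id : Fin m) + 1

theorem block_eq_block {H : Finset (Fin m)} {p q : Fin m ⊕ Fin m} :
    block H p = block H q ↔
      (p.elim id id ∈ H ∧ q.elim id id ∈ H) ∨ (p.elim id id ∉ H ∧ p.elim id id = q.elim id id) := by
  unfold block
  split_ifs with h₁ h₂ h₂
  · simp [h₁, h₂]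
  · simp [h₁, h₂]
  · simp [h₁, h₂]
    intro h
    exact h₁ (h ▸ h₂)
  · simp [h₁, h₂, Fin.ext_iff]

theorem pfSum_restrictPairs_of_even [CharZero K] (H : Finset (Fin m))
    (hH : ∀ v, Even (S.outgoing H v).card) :
    pfSum (restrictPairs H (S.tailMatrix K)) = pfSum (J (Fin m) K) := by
  let r : Fin m ⊕ Fin m → ℕ ×ₗ ℝ ×ₗ ℕ ×ₗ ℝ := fun p => toLex (block H p, S.key p)
  let b : Fin m ⊕ Fin m → ℕ ×ₗ ℝ := fun p =>
    toLex (block H p, if p.elim id id ∈ H then S.X (S.tail p) else 0)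
  have hr : Function.Injective r := fun p q h =>
    S.key_injective (congrArg (fun c => (ofLex c).2) h)
  have hbr : ∀ p q, b p < b q → r p < r q := by
    intro p q hpq
    rw [Prod.Lex.toLex_lt_toLex] at hpq ⊢
    refine hpq.imp id fun h => ⟨h.1, ?_⟩
    rcases block_eq_block.1 h.1 with ⟨hp, hq⟩ | ⟨hp, hpq'⟩
    · have h₂ := h.2
      simp only [hp, hq, if_true] at h₂
      exact S.key_lt_key_of_X_lt h₂
    · have h₂ := h.2
      simp [← hpq', hp] at h₂
  have hb : ∀ p q, b p = b q ↔ (p.elim id id ∈ H ∧ q.elim id id ∈ H ∧ S.tail p = S.tail q) ∨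
      (p.elim id id ∉ H ∧ p.elim id id = q.elim id id) := by
    intro p q
    simp only [b, EmbeddingLike.apply_eq_iff_eq, Prod.mk.injEq, block_eq_block]
    constructor
    · rintro ⟨⟨hp, hq⟩ | h, h'⟩
      · rw [if_pos hp, if_pos hq] at h'
        exact Or.inl ⟨hp, hq, S.X_injective h'⟩
      · exact Or.inr h
    · rintro (⟨hp, hq, h⟩ | ⟨hp, h⟩)
      · exact ⟨Or.inl ⟨hp, hq⟩, by rw [if_pos hp, if_pos hq, h]⟩
      · exact ⟨Or.inr ⟨hp, h⟩, by rw [← h, if_neg hp, if_neg hp]⟩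
  have heven : ∀ c, Even (Finset.univ.filter fun p => b p = c).card := by
    intro c
    rcases (Finset.univ.filter fun p => b p = c).eq_empty_or_nonempty with h | ⟨p, hp⟩
    · rw [h]
      exact Even.zero
    obtain rfl : b p = c := (Finset.mem_filter.1 hp).2
    by_cases hpH : p.elim id id ∈ H
    · have h : (Finset.univ.filter fun q => b q = b p) = S.outgoing H (S.tail p) := by
        ext q
        rw [Finset.mem_filter, hb, mem_outgoing]
        constructor
        · rintro ⟨-, ⟨h₁, -, h₂⟩ | ⟨h₁, h₂⟩⟩
          · exact ⟨h₁, h₂⟩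
          · exact absurd (h₂ ▸ hpH) h₁
        · exact fun h => ⟨Finset.mem_univ _, Or.inl ⟨h.1, hpH, h.2⟩⟩
      rw [h]
      exact hH _
    · have h : (Finset.univ.filter fun q => b q = b p) =
          {Sum.inl (p.elim id id), Sum.inr (p.elim id id)} := by
        ext q
        rw [Finset.mem_filter, hb]
        have hq : q ∈ ({Sum.inl (p.elim id id), Sum.inr (p.elim id id)} :
            Finset (Fin m ⊕ Fin m)) ↔ q.elim id id = p.elim id id := by
          rcases q with q | q <;> simp
        rw [hq]
        constructor
        · rintro ⟨-, ⟨-, h₁, -⟩ | ⟨-, h₂⟩⟩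
          · exact absurd h₁ hpH
          · exact h₂
        · exact fun h => ⟨Finset.mem_univ _, Or.inr ⟨h ▸ hpH, h⟩⟩
      rw [h, Finset.card_pair (by simp)]
      exact even_two
  have hkey : ∀ p q, block H p = block H q →
      orderSign K (r p) (r q) = orderSign K (S.key p) (S.key q) := by
    intro p q hpq
    simp [orderSign, r, Prod.Lex.toLex_lt_toLex, hpq]
  have hpair : ∀ i, r (Sum.inl i) < r (Sum.inr i) := fun i =>
    Prod.Lex.toLex_lt_toLex.2 (Or.inr ⟨rfl,
      S.key_lt_key_of_X_lt (p := Sum.inl i) (q := Sum.inr i) (S.lt i)⟩)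
  rw [← pfSum_blockTournament r hr b hbr heven hpair
    (fun e f => if e ∈ H ∧ f ∈ H then S.edgeSign K e f else 1) ?_ (S.prod_edgeSign H hH) ?_]
  · congr 1
    ext p q
    rw [restrictPairs, of_apply, of_apply]
    by_cases hp : p.elim id id ∈ H
    · by_cases hq : q.elim id id ∈ H
      · rw [if_pos ⟨hp, hq⟩, tailMatrix, of_apply]
        simp only [hb, hp, hq, hkey p q (block_eq_block.2 (Or.inl ⟨hp, hq⟩)), not_true,
          false_and, or_false, true_and]
      · simp [hb, hp, hq]
    · by_cases hq : q.elim id id ∈ H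
      · have hpq : ¬ p.elim id id = q.elim id id := fun h => hp (h ▸ hq)
        simp [hb, hp, hq, hpq]
      · by_cases hpq : p.elim id id = q.elim id id
        · rw [if_neg (fun h => hp h.1), if_pos ⟨hp, hq⟩, if_pos ((hb p q).2 (Or.inr ⟨hp, hpq⟩))]
          rcases p with p | p <;> rcases q with q | q <;>
            simp only [Sum.elim_inl, Sum.elim_inr, id] at hpq <;> subst hpq
          · simp [J, orderSign_self]
          · simp [J, orderSign_of_lt (hpair _)]
          · simp [J, orderSign_of_gt (hpair _)]
          · simp [J, orderSign_self]
        · rw [if_neg (fun h => hp h.1), if_pos ⟨hp, hq⟩, if_neg, J_apply_of_ne hpq]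
          rw [hb]
          tauto
  · intro i
    simp [S.edgeSign_self]
  · intro i j hij
    by_cases h : i ∈ H ∧ j ∈ H
    · have hk : ∀ p q : Fin m ⊕ Fin m, p.elim id id = i → q.elim id id = j →
          orderSign K (r p) (r q) = orderSign K (S.key p) (S.key q) := fun p q hp hq =>
        hkey p q (block_eq_block.2 (Or.inl ⟨hp ▸ h.1, hq ▸ h.2⟩))
      rw [hk (Sum.inl i) (Sum.inl j) rfl rfl, hk (Sum.inl i) (Sum.inr j) rfl rfl,
        hk (Sum.inr i) (Sum.inl j) rfl rfl, hk (Sum.inr i) (Sum.inr j) rfl rfl,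
        if_pos h, if_pos h.symm]
      exact S.crossSign_eq hij
    · rw [if_neg h, if_neg fun h' => h h'.symm]
      have hne : block H (Sum.inl i) ≠ block H (Sum.inl j) := by
        rw [ne_eq, block_eq_block]
        rintro (h' | ⟨-, h'⟩)
        · exact h h'
        · exact hij h'
      have hinr : ∀ k, block H (Sum.inr k) = block H (Sum.inl k) := fun k => rfl
      rcases lt_or_gt_of_ne hne with h' | h' <;>
        simp [orderSign, r, Prod.Lex.toLex_lt_toLex, hinr, h', h'.not_gt, h'.ne']

/-- The Pfaffian of the weighted matrix of a family of segments is, up to normalization, the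
generating function of the even subfamilies. -/
theorem pfSum_J_add_tailMatrix [Fintype V] [CharZero K] (x : Fin m → K) :
    pfSum (J (Fin m) K + diagonal (Sum.elim x 1) * S.tailMatrix K * diagonal (Sum.elim x 1)) =
      pfSum (J (Fin m) K) *
        ∑ H ∈ Finset.univ.filter (fun H : Finset (Fin m) => ∀ v, Even (S.outgoing H v).card),
          ∏ i ∈ H, x i := by
  rw [pfSum_J_add_diagonal_mul _ S.tailMatrix_inl_inr S.tailMatrix_inr_inl, Finset.mul_sum,
    Finset.sum_filter]
  refine Finset.sum_congr rfl fun H _ => ?_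
  split_ifs with h
  · rw [S.pfSum_restrictPairs_of_even H h, mul_comm]
  · obtain ⟨v, hv⟩ := not_forall.1 h
    rw [S.pfSum_restrictPairs_of_odd H (Nat.not_even_iff_odd.1 hv), mul_zero]

end SegmentFamily

namespace SegmentFamily

open Matrix

variable {V : Type*} [DecidableEq V] [Fintype V] {m : ℕ} (S : SegmentFamily V m)
  {K : Type*} [Field K] [CharZero K]

theorem det_one_sub_diagonal_mul_J_mul_tailMatrix (x : Fin m → K) :
    det (1 - diagonal (Sum.elim x x) * (J (Fin m) K * S.tailMatrix K)) =
      (∑ H ∈ Finset.univ.filter (fun H : Finset (Fin m) => ∀ v, Even (S.outgoing H v).card),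
        ∏ i ∈ H, x i) ^ 2 := by
  set T := S.tailMatrix K
  set D : Matrix (Fin m ⊕ Fin m) (Fin m ⊕ Fin m) K := diagonal (Sum.elim x 1) with hD
  have hX : diagonal (Sum.elim x x) * J (Fin m) K = D * (J (Fin m) K * D) := by
    have h : ∀ y : Fin m → K,
        diagonal (Sum.elim x y) = fromBlocks (diagonal x) 0 0 (diagonal y) := fun y =>
      (fromBlocks_diagonal x y).symm
    rw [hD, h x, h 1, J]
    simp [fromBlocks_multiply, -fromBlocks_diagonal]
  have hT : Tᵀ = -T := S.tailMatrix_transpose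
  have hDT : Dᵀ = D := diagonal_transpose _
  have hA : (J (Fin m) K + D * T * D)ᵀ = -(J (Fin m) K + D * T * D) := by
    rw [transpose_add, transpose_mul, transpose_mul, hT, hDT, J_transpose]
    simp only [Matrix.neg_mul, Matrix.mul_neg, neg_add, Matrix.mul_assoc]
  have h := pfSum_sq _ hA
  rw [S.pfSum_J_add_tailMatrix, mul_pow, mul_comm] at h
  rw [mul_right_cancel₀ (pow_ne_zero 2 (pfSum_J_ne_zero (n := Fin m) (R := K))) h,
    ← Matrix.mul_assoc, hX, Matrix.mul_assoc, det_one_sub_mul_comm]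
  congr 1
  rw [Matrix.mul_add, J_squared]
  simp only [Matrix.mul_assoc]
  abel

end SegmentFamily

theorem exp_half_arg_of_pos {r θ : ℝ} (hr : 0 < r) (h₁ : -Real.pi < θ) (h₂ : θ < Real.pi) :
    Complex.exp (Complex.I / 2 * (Complex.arg (r * Complex.exp (θ * Complex.I)) : ℂ)) =
      Complex.exp (Complex.I / 2 * θ) := by
  rw [Complex.exp_mul_I, Complex.arg_mul_cos_add_sin_mul_I hr ⟨h₁, h₂.le⟩]

theorem exp_half_arg_neg_of_pos {r θ : ℝ} (hr : 0 < r) (h₁ : 0 < θ) (h₂ : θ < Real.pi) :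
    Complex.exp (Complex.I / 2 * (Complex.arg (-(r * Complex.exp (θ * Complex.I))) : ℂ)) =
      -Complex.I * Complex.exp (Complex.I / 2 * θ) := by
  have h : -((r : ℂ) * Complex.exp (θ * Complex.I)) =
      r * Complex.exp ((θ - Real.pi : ℝ) * Complex.I) := by
    rw [Complex.ofReal_sub, sub_mul, Complex.exp_sub, Complex.exp_pi_mul_I]
    ring
  have h' : Complex.I / 2 * (θ - Real.pi : ℝ) =
      Complex.I / 2 * θ + -(Real.pi / 2 * Complex.I) := by
    push_cast
    ring
  rw [h, exp_half_arg_of_pos hr (by linarith) (by linarith), h', Complex.exp_add, Complex.exp_neg,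
    Complex.exp_pi_div_two_mul_I, Complex.inv_I, mul_comm]

theorem exp_half_arg_neg_of_neg {r θ : ℝ} (hr : 0 < r) (h₁ : -Real.pi < θ) (h₂ : θ < 0) :
    Complex.exp (Complex.I / 2 * (Complex.arg (-(r * Complex.exp (θ * Complex.I))) : ℂ)) =
      Complex.I * Complex.exp (Complex.I / 2 * θ) := by
  have h : -((r : ℂ) * Complex.exp (θ * Complex.I)) =
      r * Complex.exp ((θ + Real.pi : ℝ) * Complex.I) := by
    rw [Complex.ofReal_add, add_mul, Complex.exp_add, Complex.exp_pi_mul_I]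
    ring
  have h' : Complex.I / 2 * (θ + Real.pi : ℝ) =
      Complex.I / 2 * θ + Real.pi / 2 * Complex.I := by
    push_cast
    ring
  rw [h, exp_half_arg_of_pos hr (by linarith) (by linarith), h', Complex.exp_add,
    Complex.exp_pi_div_two_mul_I, mul_comm]

namespace SegmentFamily

open Matrix

variable {V : Type*} {m : ℕ} (S : SegmentFamily V m)

/-- The points of the plane as complex numbers. -/
noncomputable def point (v : V) : ℂ := ⟨S.X v, S.Y v⟩

/-- The direction of a directed segment. -/
noncomputable def direction (p : Fin m ⊕ Fin m) : ℂ :=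
  S.point (S.tail p.swap) - S.point (S.tail p)

/-- The half-turn phases of the directed segments. -/
noncomputable def phase : Fin m ⊕ Fin m → ℂ :=
  Sum.elim (fun e => Complex.exp (Complex.I / 2 * Real.arctan (S.slope e)))
    (fun e => -Complex.I * Complex.exp (Complex.I / 2 * Real.arctan (S.slope e)))

theorem phase_ne_zero (p : Fin m ⊕ Fin m) : S.phase p ≠ 0 := by
  rcases p with p | p <;> simp [phase]

theorem direction_inr (e : Fin m) : S.direction (Sum.inr e) = -S.direction (Sum.inl e) := by
  simp [direction]

theorem direction_inl (e : Fin m) : ∃ r : ℝ, 0 < r ∧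
    S.direction (Sum.inl e) = r * Complex.exp (Real.arctan (S.slope e) * Complex.I) := by
  have hx : 0 < S.X (S.R e) - S.X (S.L e) := sub_pos.2 (S.lt e)
  have hc : 0 < Real.cos (Real.arctan (S.slope e)) := Real.cos_arctan_pos _
  refine ⟨(S.X (S.R e) - S.X (S.L e)) / Real.cos (Real.arctan (S.slope e)), div_pos hx hc, ?_⟩
  have htan : Real.sin (Real.arctan (S.slope e)) =
      S.slope e * Real.cos (Real.arctan (S.slope e)) := by
    rw [← div_eq_iff hc.ne', ← Real.tan_eq_sin_div_cos, Real.tan_arctan]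
  rw [Complex.exp_mul_I, ← Complex.ofReal_cos, ← Complex.ofReal_sin, htan]
  generalize Real.cos (Real.arctan (S.slope e)) = c at hc
  apply Complex.ext
  · simp [direction, tail, point, hc.ne']
  · simp [direction, tail, point]
    rw [slope]
    field_simp

theorem direction_inl_div (e f : Fin m) : ∃ r : ℝ, 0 < r ∧
    S.direction (Sum.inl f) / S.direction (Sum.inl e) =
      r * Complex.exp ((Real.arctan (S.slope f) - Real.arctan (S.slope e) : ℝ) * Complex.I) := by
  obtain ⟨r, hr, he⟩ := S.direction_inl e
  obtain ⟨s, hs, hf⟩ := S.direction_inl f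
  refine ⟨s / r, div_pos hs hr, ?_⟩
  rw [he, hf, Complex.ofReal_sub, sub_mul, Complex.exp_sub, Complex.ofReal_div, mul_div_mul_comm]

/-- The half-turn factor from a directed segment to one of its successors. -/
theorem exp_half_arg_direction_div (p q : Fin m ⊕ Fin m) (h : S.tail p.swap = S.tail q)
    (hpq : q ≠ p.swap) :
    Complex.exp (Complex.I / 2 * (Complex.arg (S.direction q / S.direction p) : ℂ)) =
      (Sum.elim (fun _ => 1) (fun _ => -1) p : ℂ) *
        orderSign ℂ (S.key p.swap) (S.key q) * S.phase q / S.phase p := by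
  have hb : ∀ a b : ℝ, -Real.pi < Real.arctan a - Real.arctan b ∧
      Real.arctan a - Real.arctan b < Real.pi := fun a b => by
    have h₁ := Real.neg_pi_div_two_lt_arctan a
    have h₂ := Real.arctan_lt_pi_div_two a
    have h₃ := Real.neg_pi_div_two_lt_arctan b
    have h₄ := Real.arctan_lt_pi_div_two b
    constructor <;> linarith
  have hexp : ∀ a b : ℝ, Complex.exp (Complex.I / 2 * (Real.arctan a - Real.arctan b : ℝ)) =
      Complex.exp (Complex.I / 2 * Real.arctan a) / Complex.exp (Complex.I / 2 * Real.arctan b) :=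
    fun a b => by rw [Complex.ofReal_sub, mul_sub, Complex.exp_sub]
  rcases p with e | e <;> rcases q with f | f <;>
    simp only [Sum.swap_inl, Sum.swap_inr, tail, Sum.elim_inl, Sum.elim_inr, ne_eq,
      Sum.inl.injEq, Sum.inr.injEq, direction_inr, neg_div, div_neg, neg_neg, phase]
      at h hpq ⊢ <;>
    obtain ⟨r, hr, hd⟩ := S.direction_inl_div e f <;> rw [hd]
  · rw [exp_half_arg_of_pos hr (hb _ _).1 (hb _ _).2, hexp,
      orderSign_of_lt (S.key_inr_lt_key_inl h)]
    ring
  · rcases lt_or_gt_of_ne (S.slope_ne_of_R_eq (Ne.symm hpq) h) with hs | hs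
    · rw [exp_half_arg_neg_of_pos hr (sub_pos.2 (Real.arctan_lt_arctan_iff.2 hs)) (hb _ _).2, hexp,
        orderSign_of_lt ((S.key_inr_lt_key_inr h).2 hs)]
      ring
    · rw [exp_half_arg_neg_of_neg hr (hb _ _).1 (sub_neg.2 (Real.arctan_lt_arctan_iff.2 hs)), hexp,
        orderSign_of_gt ((S.key_inr_lt_key_inr h.symm).2 hs)]
      ring
  · have hI : ∀ a b : ℂ, a / (-Complex.I * b) = Complex.I * (a / b) := fun a b => by
      rw [mul_comm, ← div_div, div_neg, Complex.div_I]
      ring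
    rcases lt_or_gt_of_ne (S.slope_ne_of_L_eq (Ne.symm hpq) h) with hs | hs
    · rw [exp_half_arg_neg_of_pos hr (sub_pos.2 (Real.arctan_lt_arctan_iff.2 hs)) (hb _ _).2, hexp,
        orderSign_of_lt ((S.key_inl_lt_key_inl h).2 hs), hI]
      ring
    · rw [exp_half_arg_neg_of_neg hr (hb _ _).1 (sub_neg.2 (Real.arctan_lt_arctan_iff.2 hs)), hexp,
        orderSign_of_gt ((S.key_inl_lt_key_inl h.symm).2 hs), hI]
      ring
  · rw [exp_half_arg_of_pos hr (hb _ _).1 (hb _ _).2, hexp,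
      orderSign_of_gt (S.key_inr_lt_key_inl h.symm), neg_mul_neg, one_mul, one_mul,
      mul_div_mul_left _ _ (neg_ne_zero.2 Complex.I_ne_zero)]

end SegmentFamily

namespace SegmentFamily

open Matrix

variable {V : Type*} [DecidableEq V] {m : ℕ} (S : SegmentFamily V m)

theorem mul_J_mul_tailMatrix_mul_eq (x : Fin m → ℂ) (p q : Fin m ⊕ Fin m) :
    (diagonal (fun p => (S.phase p)⁻¹) *
      (diagonal (Sum.elim x x) * (J (Fin m) ℂ * S.tailMatrix ℂ)) * diagonal S.phase) p q =
      if S.tail p.swap = S.tail q ∧ q ≠ p.swap then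
        x (p.elim id id) * Complex.exp (Complex.I / 2 *
          (Complex.arg (S.direction q / S.direction p) : ℂ)) else 0 := by
  have hJ : (J (Fin m) ℂ * S.tailMatrix ℂ) p q =
      -(Sum.elim (fun _ => 1) (fun _ => -1) p : ℂ) * S.tailMatrix ℂ p.swap q := by
    rw [mul_apply, Fintype.sum_sum_type]
    rcases p with p | p <;> simp [J, one_apply]
  rw [mul_diagonal, diagonal_mul, diagonal_mul, hJ, tailMatrix, of_apply]
  by_cases h : S.tail p.swap = S.tail q
  · by_cases hpq : q = p.swap
    · subst hpq
      simp [orderSign_self]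
    · rw [if_pos h, if_pos ⟨h, hpq⟩, S.exp_half_arg_direction_div p q h hpq]
      rcases p with p | p <;> simp only [Sum.elim_inl, Sum.elim_inr, id] <;> ring
  · rw [if_neg h, if_neg (fun h' => h h'.1)]
    simp

theorem det_one_sub_of_forall_eq [Fintype V] {ι : Type*} [Fintype ι] [DecidableEq ι]
    (ψ : Fin m ⊕ Fin m ≃ ι) (A : Matrix ι ι ℂ) (x : Fin m → ℂ)
    (hA : ∀ p q, A (ψ p) (ψ q) = if S.tail p.swap = S.tail q ∧ q ≠ p.swap then
        x (p.elim id id) * Complex.exp (Complex.I / 2 *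
          (Complex.arg (S.direction q / S.direction p) : ℂ)) else 0) :
    det (1 - A) =
      (∑ H ∈ Finset.univ.filter (fun H : Finset (Fin m) => ∀ v, Even (S.outgoing H v).card),
        ∏ i ∈ H, x i) ^ 2 := by
  rw [← S.det_one_sub_diagonal_mul_J_mul_tailMatrix, ← det_submatrix_equiv_self ψ]
  have hphase : diagonal (fun p => (S.phase p)⁻¹) * diagonal S.phase = 1 := by
    rw [diagonal_mul_diagonal, ← diagonal_one]
    exact congrArg _ (funext fun p => inv_mul_cancel₀ (S.phase_ne_zero p))
  have h : (1 - A).submatrix ψ ψ = diagonal (fun p => (S.phase p)⁻¹) *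
      (1 - diagonal (Sum.elim x x) * (J (Fin m) ℂ * S.tailMatrix ℂ)) * diagonal S.phase := by
    rw [Matrix.mul_sub, Matrix.sub_mul, Matrix.mul_one, hphase]
    ext p q
    rw [submatrix_apply, Matrix.sub_apply, Matrix.sub_apply, hA, S.mul_J_mul_tailMatrix_mul_eq,
      one_apply, one_apply]
    simp only [ψ.apply_eq_iff_eq]
  rw [h, det_mul, det_mul, mul_right_comm, ← det_mul, hphase, det_one, one_mul]

theorem card_outgoing (H : Finset (Fin m)) (v : V) :
    (S.outgoing H v).card = (H.filter fun e => v ∈ s(S.L e, S.R e)).card := by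
  refine Finset.card_nbij (fun p => p.elim id id) ?_ ?_ ?_
  · intro p hp
    rw [Finset.mem_coe, mem_outgoing] at hp
    rw [Finset.mem_coe, Finset.mem_filter]
    refine ⟨hp.1, ?_⟩
    rcases p with p | p
    · exact Sym2.mem_iff.2 (Or.inl hp.2.symm)
    · exact Sym2.mem_iff.2 (Or.inr hp.2.symm)
  · intro p hp q hq hpq
    rw [Finset.mem_coe, mem_outgoing] at hp hq
    have h := hp.2.trans hq.2.symm
    rcases p with p | p <;> rcases q with q | q <;> obtain rfl : p = q := hpq
    · rfl
    · exact absurd h (S.L_ne_R p)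
    · exact absurd h.symm (S.L_ne_R p)
    · rfl
  · intro e he
    rw [Finset.mem_coe, Finset.mem_filter, Sym2.mem_iff] at he
    rcases he with ⟨he, rfl | rfl⟩
    · exact ⟨Sum.inl e, Finset.mem_coe.2 (S.mem_outgoing.2 ⟨he, rfl⟩), rfl⟩
    · exact ⟨Sum.inr e, Finset.mem_coe.2 (S.mem_outgoing.2 ⟨he, rfl⟩), rfl⟩

end SegmentFamily

theorem exists_mul_re_injective {V : Type*} [Finite V] (z : V → ℂ) (hz : Function.Injective z) :
    ∃ u : ℂ, u ≠ 0 ∧ Function.Injective fun v => (u * z v).re := by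
  have hfin : (Set.range fun p : V × V =>
      (z p.1 - z p.2).re / (z p.1 - z p.2).im).Finite := Set.finite_range _
  obtain ⟨t, ht⟩ := hfin.infinite_compl.nonempty
  refine ⟨⟨1, t⟩, fun h => one_ne_zero (congrArg Complex.re h), fun v w hvw => ?_⟩
  by_contra hne
  have h : (z v - z w).re = t * (z v - z w).im := by
    simp only [Complex.mul_re, one_mul] at hvw
    rw [Complex.sub_re, Complex.sub_im]
    linarith
  by_cases him : (z v - z w).im = 0
  · rw [him, mul_zero] at h
    exact hne (hz (sub_eq_zero.1 (Complex.ext h him)))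
  · exact ht ⟨(v, w), (eq_div_iff him).2 h.symm |>.symm⟩

namespace PlaneGraph

variable (G : PlaneGraph)

/-- The directed edges pointing to the right after multiplication by `u`. -/
abbrev RightEdge (u : ℂ) : Type :=
  {d : G.DEdge // (u * G.pos d.val.1).re < (u * G.pos d.val.2).re}

/-- The edges of a plane graph, rotated and scaled by `u`, as a family of segments. -/
noncomputable def toSegmentFamily {u : ℂ} (hu : u ≠ 0)
    (hre : Function.Injective fun v => (u * G.pos v).re) {m : ℕ} (φ : Fin m ≃ G.RightEdge u) :
    SegmentFamily G.V m where
  X v := (u * G.pos v).re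
  Y v := (u * G.pos v).im
  X_injective := hre
  L e := (φ e).val.val.1
  R e := (φ e).val.val.2
  lt e := (φ e).property
  meet e f hef x he he' hf hf' h := by
    have hlt := fun e => (φ e).property
    let P : Fin m → ℂ := fun e => G.pos (φ e).val.val.1 +
      ((x - (u * G.pos (φ e).val.val.1).re) /
        ((u * G.pos (φ e).val.val.2).re - (u * G.pos (φ e).val.val.1).re) : ℝ) •
        (G.pos (φ e).val.val.2 - G.pos (φ e).val.val.1)
    have hseg : ∀ e, (u * G.pos (φ e).val.val.1).re ≤ x → x ≤ (u * G.pos (φ e).val.val.2).re →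
        P e ∈ segOf G.pos s((φ e).val.val.1, (φ e).val.val.2) := by
      intro e h₁ h₂
      have hpos := sub_pos.2 (hlt e)
      change P e ∈ segment ℝ _ _
      rw [segment_eq_image']
      exact ⟨_, ⟨div_nonneg (by linarith) hpos.le, (div_le_one hpos).2 (by linarith)⟩, rfl⟩
    have huP : ∀ e, u * P e = u * G.pos (φ e).val.val.1 +
        ((x - (u * G.pos (φ e).val.val.1).re) /
        ((u * G.pos (φ e).val.val.2).re - (u * G.pos (φ e).val.val.1).re) : ℝ) *
        (u * G.pos (φ e).val.val.2 - u * G.pos (φ e).val.val.1) := by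
      intro e
      simp only [P, Complex.real_smul]
      ring
    have hPre : ∀ e, (u * P e).re = x := by
      intro e
      have hpos := sub_pos.2 (hlt e)
      rw [huP, Complex.add_re, Complex.re_ofReal_mul, Complex.sub_re, div_mul_cancel₀ _ hpos.ne']
      ring
    have hPim : (u * P e).im = (u * P f).im := by
      rw [huP, huP, Complex.add_im, Complex.im_ofReal_mul, Complex.sub_im,
        Complex.add_im, Complex.im_ofReal_mul, Complex.sub_im]
      convert h using 2 <;> ring
    have hP : P e = P f :=
      mul_left_cancel₀ hu (Complex.ext ((hPre e).trans (hPre f).symm) hPim)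
    have hne : s((φ e).val.val.1, (φ e).val.val.2) ≠ s((φ f).val.val.1, (φ f).val.val.2) := by
      intro h'
      rcases Sym2.eq_iff.1 h' with ⟨h₁, h₂⟩ | ⟨h₁, h₂⟩
      · exact hef (φ.injective (Subtype.ext (Subtype.ext (Prod.ext h₁ h₂))))
      · have h₃ := hlt e
        rw [h₁, h₂] at h₃
        exact h₃.not_gt (hlt f)
    obtain ⟨w, hwe, hwf, hw⟩ := G.edges_meet _ (φ e).val.property _ (φ f).val.property hne (P e)
      (hseg e he he') (hP ▸ hseg f hf hf')
    exact ⟨w, by rw [← hPre e, hw], Sym2.mem_iff.1 hwe, Sym2.mem_iff.1 hwf⟩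

theorem rev_rev (d : G.DEdge) : G.rev (G.rev d) = d := rfl

/-- The directed edges as two copies of those pointing to the right. -/
noncomputable def dEdgeEquiv {u : ℂ} (hre : Function.Injective fun v => (u * G.pos v).re)
    {m : ℕ} (φ : Fin m ≃ G.RightEdge u) : Fin m ⊕ Fin m ≃ G.DEdge :=
  Equiv.ofBijective (Sum.elim (fun e => (φ e).val) (fun e => G.rev (φ e).val)) (by
    constructor
    · have h₁ : ∀ e f, (φ e).val ≠ G.rev (φ f).val := by
        intro e f h
        have he := (φ e).property
        rw [h] at he
        exact he.not_gt (φ f).property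
      rintro (e | e) (f | f) h
      · exact congrArg _ (φ.injective (Subtype.ext h))
      · exact absurd h (h₁ e f)
      · exact absurd h.symm (h₁ f e)
      · exact congrArg _ (φ.injective (Subtype.ext (congrArg G.rev h)))
    · intro d
      have hd : d.val.1 ≠ d.val.2 := fun h => G.not_diag _ d.property (Sym2.mk_isDiag_iff.2 h)
      rcases lt_or_gt_of_ne (hre.ne hd) with h | h
      · exact ⟨Sum.inl (φ.symm ⟨d, h⟩), by simp⟩
      · exact ⟨Sum.inr (φ.symm ⟨G.rev d, h⟩), by simp [rev_rev]⟩)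

theorem dEdgeEquiv_swap {u : ℂ} (hre : Function.Injective fun v => (u * G.pos v).re)
    {m : ℕ} (φ : Fin m ≃ G.RightEdge u) (p : Fin m ⊕ Fin m) :
    G.dEdgeEquiv hre φ p.swap = G.rev (G.dEdgeEquiv hre φ p) := by
  rcases p with p | p <;> rfl

theorem Z_eq_sum {m : ℕ} (S : SegmentFamily G.V m)
    (hS : Function.Injective fun e => s(S.L e, S.R e))
    (hE : ∀ d, d ∈ G.E ↔ ∃ e, s(S.L e, S.R e) = d)
    (x : Sym2 G.V → ℝ) :
    G.Z x = ∑ H ∈ Finset.univ.filter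
      (fun H : Finset (Fin m) => ∀ v, Even (S.outgoing H v).card),
        ∏ e ∈ H, x s(S.L e, S.R e) := by
  let ε : Fin m ↪ Sym2 G.V := ⟨fun e => s(S.L e, S.R e), hS⟩
  have hcard : ∀ (H : Finset (Fin m)) (v : G.V),
      (S.outgoing H v).card = ((H.map ε).filter fun e => v ∈ e).card := by
    intro H v
    rw [S.card_outgoing, Finset.filter_map, Finset.card_map]
    rfl
  rw [Z]
  symm
  refine Finset.sum_nbij (fun H => H.map ε) ?_ ?_ ?_ ?_
  · intro H hH
    rw [Finset.mem_filter] at hH ⊢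
    refine ⟨Finset.mem_powerset.2 fun d hd => ?_, fun v => hcard H v ▸ hH.2 v⟩
    obtain ⟨e, -, rfl⟩ := Finset.mem_map.1 hd
    exact (hE _).2 ⟨e, rfl⟩
  · exact (Finset.map_injective _).injOn
  · intro F hF
    rw [Finset.mem_coe, Finset.mem_filter, Finset.mem_powerset] at hF
    have hFmap : (Finset.univ.filter fun e => ε e ∈ F).map ε = F := by
      ext d
      rw [Finset.mem_map]
      simp only [Finset.mem_filter, Finset.mem_univ, true_and]
      constructor
      · rintro ⟨e, he, rfl⟩
        exact he
      · intro hd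
        obtain ⟨e, rfl⟩ := (hE d).1 (hF.1 hd)
        exact ⟨e, hd, rfl⟩
    refine ⟨Finset.univ.filter fun e => ε e ∈ F, ?_, hFmap⟩
    rw [Finset.mem_coe, Finset.mem_filter]
    exact ⟨Finset.mem_univ _, fun v => by rw [hcard, hFmap]; exact hF.2 v⟩
  · intro H _
    rw [Finset.prod_map]
    rfl

section Edges

variable {u : ℂ} (hu : u ≠ 0) (hre : Function.Injective fun v => (u * G.pos v).re) {m : ℕ}
  (φ : Fin m ≃ G.RightEdge u)

theorem tail_toSegmentFamily (p : Fin m ⊕ Fin m) :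
    (G.toSegmentFamily hu hre φ).tail p = (G.dEdgeEquiv hre φ p).val.1 := by
  rcases p with p | p <;> rfl

theorem tail_swap_toSegmentFamily (p : Fin m ⊕ Fin m) :
    (G.toSegmentFamily hu hre φ).tail p.swap = (G.dEdgeEquiv hre φ p).val.2 := by
  rcases p with p | p <;> rfl

theorem undir_dEdgeEquiv (p : Fin m ⊕ Fin m) :
    G.undir (G.dEdgeEquiv hre φ p) = s((G.toSegmentFamily hu hre φ).L (p.elim id id),
      (G.toSegmentFamily hu hre φ).R (p.elim id id)) := by
  rcases p with p | p
  · rfl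
  · exact Sym2.eq_swap

theorem direction_toSegmentFamily (p : Fin m ⊕ Fin m) :
    (G.toSegmentFamily hu hre φ).direction p =
      u * (G.pos (G.dEdgeEquiv hre φ p).val.2 - G.pos (G.dEdgeEquiv hre φ p).val.1) := by
  rw [SegmentFamily.direction, tail_swap_toSegmentFamily, tail_toSegmentFamily, mul_sub]
  rfl

theorem edge_toSegmentFamily_injective : Function.Injective fun e =>
    s((G.toSegmentFamily hu hre φ).L e, (G.toSegmentFamily hu hre φ).R e) := by
  intro e f hef
  rcases Sym2.eq_iff.1 hef with ⟨h₁, h₂⟩ | ⟨h₁, h₂⟩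
  · exact φ.injective (Subtype.ext (Subtype.ext (Prod.ext h₁ h₂)))
  · have h₃ := (G.toSegmentFamily hu hre φ).lt e
    rw [h₁, h₂] at h₃
    exact absurd ((G.toSegmentFamily hu hre φ).lt f) h₃.not_gt

theorem mem_E_iff_toSegmentFamily (d : Sym2 G.V) : d ∈ G.E ↔
    ∃ e, s((G.toSegmentFamily hu hre φ).L e, (G.toSegmentFamily hu hre φ).R e) = d := by
  constructor
  · induction d using Sym2.ind with
    | _ a b =>
      intro hd
      obtain ⟨p, hp⟩ := (G.dEdgeEquiv hre φ).surjective ⟨(a, b), hd⟩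
      exact ⟨_, (G.undir_dEdgeEquiv hu hre φ p).symm.trans (by rw [hp]; rfl)⟩
  · rintro ⟨e, rfl⟩
    exact (φ e).val.property

theorem transMatrix_dEdgeEquiv (x : Sym2 G.V → ℝ) (p q : Fin m ⊕ Fin m) :
    G.transMatrix x (G.dEdgeEquiv hre φ p) (G.dEdgeEquiv hre φ q) =
      if (G.toSegmentFamily hu hre φ).tail p.swap = (G.toSegmentFamily hu hre φ).tail q ∧
          q ≠ p.swap then
        (x s((G.toSegmentFamily hu hre φ).L (p.elim id id),
          (G.toSegmentFamily hu hre φ).R (p.elim id id)) : ℂ) *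
          Complex.exp (Complex.I / 2 * (Complex.arg ((G.toSegmentFamily hu hre φ).direction q /
            (G.toSegmentFamily hu hre φ).direction p) : ℂ)) else 0 := by
  rw [transMatrix, tangle, undir_dEdgeEquiv G hu, direction_toSegmentFamily,
    direction_toSegmentFamily, mul_div_mul_left _ _ hu]
  refine if_congr ?_ rfl rfl
  rw [tail_swap_toSegmentFamily, tail_toSegmentFamily, ← dEdgeEquiv_swap, ne_eq,
    (G.dEdgeEquiv hre φ).apply_eq_iff_eq]

end Edges

end PlaneGraph

/-- **Kac–Ward formula.** For a finite graph embedded in the plane with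
non-intersecting straight edges and real edge weights `x`,
`det(Id - Λ) = Z²`, where `Z` is the generating function of even subgraphs. -/
theorem kac_ward_formula (G : PlaneGraph) (x : Sym2 G.V → ℝ) :
    Matrix.det (1 - G.transMatrix x) = ((G.Z x : ℝ) : ℂ) ^ 2 := by
  obtain ⟨u, hu, hre⟩ := exists_mul_re_injective G.pos G.pos_inj
  obtain ⟨m, ⟨φ⟩⟩ := Finite.exists_equiv_fin (G.RightEdge u)
  rw [(G.toSegmentFamily hu hre φ.symm).det_one_sub_of_forall_eq (G.dEdgeEquiv hre φ.symm)
    (G.transMatrix x) (fun e => (x s((G.toSegmentFamily hu hre φ.symm).L e,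
      (G.toSegmentFamily hu hre φ.symm).R e) : ℂ)) (G.transMatrix_dEdgeEquiv hu hre φ.symm x),
    G.Z_eq_sum _ (G.edge_toSegmentFamily_injective hu hre φ.symm)
      (G.mem_E_iff_toSegmentFamily hu hre φ.symm)]
  push_cast
  rfl
end

section
/- For any self-avoiding loop ℓ, one has λ(ℓ) = −x(ℓ). -/
open scoped BigOperators

/-- The half-turn factor `exp((i/2) Arg(b/a))` from the direction `a` to the direction `b`. -/
noncomputable def halfTurn (a b : ℂ) : ℂ :=
  Complex.exp (Complex.I / 2 * (Complex.arg (b / a) : ℂ))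

lemma halfTurn_neg_neg (a b : ℂ) : halfTurn (-a) (-b) = halfTurn a b := by
  simp [halfTurn]

lemma halfTurn_mul_left {c : ℂ} (hc : c ≠ 0) (a b : ℂ) :
    halfTurn (c * a) (c * b) = halfTurn a b := by
  simp [halfTurn, mul_div_mul_left _ _ hc]

lemma halfTurn_sq {a b : ℂ} (ha : a ≠ 0) (hb : b ≠ 0) :
    halfTurn a b ^ 2 = (b / ‖b‖) / (a / ‖a‖) := by
  have h : b / a ≠ 0 := div_ne_zero hb ha
  have h1 : halfTurn a b ^ 2 = Complex.exp (Complex.arg (b / a) * Complex.I) := by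
    rw [halfTurn, ← Complex.exp_nat_mul]
    congr 1
    push_cast
    ring
  have h2 := Complex.norm_mul_exp_arg_mul_I (b / a)
  have ha' : (‖a‖ : ℂ) ≠ 0 := by simpa using ha
  have hb' : (‖b‖ : ℂ) ≠ 0 := by simpa using hb
  rw [h1]
  rw [norm_div, Complex.ofReal_div] at h2
  field_simp at h2 ⊢
  linear_combination h2

lemma halfTurn_eq_div_of_re_pos {a b : ℂ} (ha : 0 < a.re) (hb : 0 < b.re) :
    halfTurn a b = halfTurn 1 b / halfTurn 1 a := by
  have ha0 : a ≠ 0 := by rintro rfl; simp at ha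
  have hb0 : b ≠ 0 := by rintro rfl; simp at hb
  have h1 := abs_lt.1 (Complex.abs_arg_lt_pi_div_two_iff.2 (Or.inl ha))
  have h2 := abs_lt.1 (Complex.abs_arg_lt_pi_div_two_iff.2 (Or.inl hb))
  have hinv : Complex.arg a⁻¹ = -Complex.arg a := by
    rw [Complex.arg_inv, if_neg]
    linarith [Real.pi_pos]
  have h3 : Complex.arg (b / a) = Complex.arg b - Complex.arg a := by
    rw [div_eq_mul_inv, Complex.arg_mul hb0 (inv_ne_zero ha0), hinv, sub_eq_add_neg]
    rw [hinv]
    constructor <;> linarith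
  simp only [halfTurn, h3, div_one]
  rw [← Complex.exp_sub]
  congr 1
  push_cast
  ring

/-- Half-turns compose along directions lying in a common open half-plane. -/
lemma halfTurn_mul_halfTurn {a b c w : ℂ} (ha : 0 < (w * a).re) (hb : 0 < (w * b).re)
    (hc : 0 < (w * c).re) : halfTurn a b * halfTurn b c = halfTurn a c := by
  have hw : w ≠ 0 := by rintro rfl; simp at ha
  rw [← halfTurn_mul_left hw a b, ← halfTurn_mul_left hw b c, ← halfTurn_mul_left hw a c,
    halfTurn_eq_div_of_re_pos ha hb, halfTurn_eq_div_of_re_pos hb hc,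
    halfTurn_eq_div_of_re_pos ha hc, mul_comm, div_mul_div_cancel₀]
  exact Complex.exp_ne_zero _

/-- Disjoint segments are strictly separated by a real linear functional. -/
lemma exists_re_pos_of_disjoint_segment {p q r t : ℂ}
    (h : Disjoint (segment ℝ p q) (segment ℝ r t)) :
    ∃ w : ℂ, ∀ x ∈ segment ℝ p q, ∀ y ∈ segment ℝ r t, 0 < (w * (y - x)).re := by
  have hcomp (a b : ℂ) : IsCompact (segment ℝ a b) := by
    rw [← convexHull_pair]
    exact ((Set.finite_singleton b).insert a).isCompact_convexHull (𝕜 := ℝ)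
  obtain ⟨f, u, v, h1, huv, h2⟩ := geometric_hahn_banach_compact_closed
    (convex_segment p q) (hcomp p q) (convex_segment r t) (hcomp r t).isClosed h
  refine ⟨f 1 - Complex.I * f Complex.I, fun x hx y hy => ?_⟩
  have hf (z : ℂ) : ((f 1 - Complex.I * f Complex.I) * z).re = f z := by
    have hz : z = z.re • (1 : ℂ) + z.im • Complex.I := by
      apply Complex.ext <;> simp
    conv_rhs => rw [hz, map_add, map_smul, map_smul]
    simp
    ring
  rw [hf, map_sub]
  linarith [h1 x hx, h2 y hy]

lemma halfTurn_square {p q r t : ℂ} (h : Disjoint (segment ℝ p q) (segment ℝ r t)) :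
    halfTurn (r - p) (t - p) * halfTurn (t - p) (t - q) =
      halfTurn (r - p) (r - q) * halfTurn (r - q) (t - q) := by
  obtain ⟨w, hw⟩ := exists_re_pos_of_disjoint_segment h
  have hp := left_mem_segment ℝ p q
  have hq := right_mem_segment ℝ p q
  have hr := left_mem_segment ℝ r t
  have ht := right_mem_segment ℝ r t
  rw [halfTurn_mul_halfTurn (hw p hp r hr) (hw p hp t ht) (hw q hq t ht),
    halfTurn_mul_halfTurn (hw p hp r hr) (hw q hq r hr) (hw q hq t ht)]

lemma halfTurn_triangle {a b : ℂ} (h : (0 : ℂ) ∉ segment ℝ a b) :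
    halfTurn a (a + b) * halfTurn (a + b) b = halfTurn a b := by
  have hd : Disjoint (segment ℝ (0 : ℂ) 0) (segment ℝ a b) := by
    simpa [segment_same] using h
  obtain ⟨w, hw⟩ := exists_re_pos_of_disjoint_segment hd
  have h0 := left_mem_segment ℝ (0 : ℂ) 0
  have ha := hw 0 h0 a (left_mem_segment ℝ a b)
  have hb := hw 0 h0 b (right_mem_segment ℝ a b)
  rw [sub_zero] at ha hb
  refine halfTurn_mul_halfTurn ha ?_ hb
  rw [mul_add, Complex.add_re]
  exact add_pos ha hb

lemma halfTurn_mul_halfTurn_neg {p q : ℂ} (hp : p ≠ 0) (hq : q ≠ 0) :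
    (p / ‖p‖) / (q / ‖q‖) * halfTurn p (-q) * halfTurn (-p) q = -1 := by
  have h : halfTurn (-p) q = halfTurn p (-q) := by
    rw [← halfTurn_neg_neg p (-q), neg_neg]
  have hp' : (‖p‖ : ℂ) ≠ 0 := by simpa using hp
  have hq' : (‖q‖ : ℂ) ≠ 0 := by simpa using hq
  rw [h, mul_assoc, ← sq, halfTurn_sq hp (neg_ne_zero.2 hq), norm_neg]
  field_simp

/-- Squared half-turns telescope. -/
lemma prod_halfTurn_sq (d : ℕ → ℂ) (k : ℕ) (hd : ∀ i ≤ k, d i ≠ 0) :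
    (∏ i ∈ Finset.range k, halfTurn (d i) (d (i + 1))) ^ 2 =
      (d k / ‖d k‖) / (d 0 / ‖d 0‖) := by
  rw [← Finset.prod_pow]
  have h0 : ∀ i ≤ k, d i / (‖d i‖ : ℂ) ≠ 0 := fun i hi =>
    div_ne_zero (hd i hi) (by simpa using hd i hi)
  induction k with
  | zero => simpa using (div_self (h0 0 le_rfl)).symm
  | succ k ih =>
    rw [Finset.prod_range_succ, ih (fun i hi => hd i (by omega)) (fun i hi => h0 i (by omega)),
      halfTurn_sq (hd k (by omega)) (hd (k + 1) le_rfl), mul_comm, div_mul_div_cancel₀]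
    exact h0 k (by omega)

section Polygon

variable {v : ℕ → ℂ}

/-- Sliding a horizontal step past a column of the secant grid. -/
lemma prod_halfTurn_slide (j m a : ℕ)
    (h : ∀ i, a ≤ i → i < a + m →
      Disjoint (segment ℝ (v i) (v (i + 1))) (segment ℝ (v j) (v (j + 1)))) :
    (∏ i ∈ Finset.range m, halfTurn (v j - v (a + i)) (v j - v (a + i + 1))) *
        halfTurn (v j - v (a + m)) (v (j + 1) - v (a + m)) =
      halfTurn (v j - v a) (v (j + 1) - v a) *
        ∏ i ∈ Finset.range m, halfTurn (v (j + 1) - v (a + i)) (v (j + 1) - v (a + i + 1)) := by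
  induction m with
  | zero => simp
  | succ m ih =>
    have ih := ih fun i h1 h2 => h i h1 (by omega)
    have hs := halfTurn_square (h (a + m) (by omega) (by omega))
    rw [Finset.prod_range_succ, Finset.prod_range_succ, ← mul_assoc, ← ih, mul_assoc, mul_assoc,
      ← add_assoc, hs]

/-- The turning along the polygonal path from the edge `0` to the edge `k` equals the turning of
the secants along the first row and then the last column of the secant grid. -/
lemma prod_halfTurn_path (k : ℕ)
    (hdis : ∀ i j, i + 1 < j → j ≤ k →
      Disjoint (segment ℝ (v i) (v (i + 1))) (segment ℝ (v j) (v (j + 1))))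
    (hadj : ∀ i < k, (0 : ℂ) ∉ segment ℝ (v (i + 1) - v i) (v (i + 2) - v (i + 1))) :
    ∏ i ∈ Finset.range k, halfTurn (v (i + 1) - v i) (v (i + 2) - v (i + 1)) =
      (∏ j ∈ Finset.range k, halfTurn (v (j + 1) - v 0) (v (j + 2) - v 0)) *
        ∏ i ∈ Finset.range k, halfTurn (v (k + 1) - v i) (v (k + 1) - v (i + 1)) := by
  induction k with
  | zero => simp
  | succ k ih =>
    have hs := prod_halfTurn_slide (v := v) (k + 1) k 0
      fun i _ hi => hdis i (k + 1) (by omega) le_rfl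
    have ht := halfTurn_triangle (hadj k (by omega))
    rw [show v (k + 1) - v k + (v (k + 2) - v (k + 1)) = v (k + 2) - v k by ring] at ht
    simp only [zero_add] at hs
    rw [Finset.prod_range_succ, ih (fun i j h1 h2 => hdis i j h1 (by omega))
      (fun i hi => hadj i (by omega)), Finset.prod_range_succ, Finset.prod_range_succ _ k, ← ht]
    simp only [add_assoc, Nat.reduceAdd] at hs ⊢
    linear_combination (∏ j ∈ Finset.range k, halfTurn (v (j + 1) - v 0) (v (j + 2) - v 0)) *
      halfTurn (v (k + 2) - v k) (v (k + 2) - v (k + 1)) * hs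

/-- Hopf's Umlaufsatz for polygons, in terms of half-turns: the half-turn factors of a simple
closed polygon with `m + 3` vertices multiply to `-1`. -/
theorem prod_halfTurn_polygon (m : ℕ) (hv : v (m + 3) = v 0)
    (hinj : ∀ j, 0 < j → j < m + 3 → v j ≠ v 0)
    (hdis : ∀ i j, i + 1 < j → j < m + 3 → (i = 0 → j ≠ m + 2) →
      Disjoint (segment ℝ (v i) (v (i + 1))) (segment ℝ (v j) (v (j + 1))))
    (hadj : ∀ i < m + 2, (0 : ℂ) ∉ segment ℝ (v (i + 1) - v i) (v (i + 2) - v (i + 1)))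
    (hlast : (0 : ℂ) ∉ segment ℝ (v 0 - v (m + 2)) (v 1 - v 0)) :
    (∏ i ∈ Finset.range (m + 2), halfTurn (v (i + 1) - v i) (v (i + 2) - v (i + 1))) *
      halfTurn (v 0 - v (m + 2)) (v 1 - v 0) = -1 := by
  have hp : v (m + 2) - v 0 ≠ 0 := sub_ne_zero.2 (hinj _ (by omega) (by omega))
  have hq : v 1 - v 0 ≠ 0 := sub_ne_zero.2 (hinj _ (by omega) (by omega))
  have hpath := prod_halfTurn_path (v := v) (m + 1)
    (fun i j h1 h2 => hdis i j h1 (by omega) (by omega)) (fun i hi => hadj i (by omega))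
  have ht := halfTurn_triangle (hadj (m + 1) (by omega))
  rw [show v (m + 1 + 1) - v (m + 1) + (v (m + 1 + 2) - v (m + 1 + 1)) =
    v (m + 3) - v (m + 1) by ring_nf] at ht
  have hs := prod_halfTurn_slide (v := v) (m + 2) m 1
    fun i h1 h2 => hdis i (m + 2) (by omega) (by omega) (by omega)
  have hcorner : halfTurn (v (m + 2) - v 0) (v (m + 2) - v 1) *
      halfTurn (v (m + 2) - v 1) (v 0 - v 1) =
        halfTurn (v (m + 2) - v 0) (-(v 1 - v 0)) := by
    have h : (0 : ℂ) ∉ segment ℝ (v (m + 2) - v 0) (-(v 1 - v 0)) := by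
      rintro ⟨s, t, hs, ht, hst, h⟩
      exact hlast ⟨s, t, hs, ht, hst, by rw [← neg_eq_zero, ← h]; module⟩
    have := halfTurn_triangle h
    rwa [show v (m + 2) - v 0 + -(v 1 - v 0) = v (m + 2) - v 1 by ring,
      show halfTurn (v (m + 2) - v 1) (-(v 1 - v 0)) =
        halfTurn (v (m + 2) - v 1) (v 0 - v 1) by rw [neg_sub]] at this
  have hsq := prod_halfTurn_sq (fun i => v (i + 1) - v 0) (m + 1)
    fun i hi => sub_ne_zero.2 (hinj _ (by omega) (by omega))
  have hA : ∏ i ∈ Finset.range (m + 1), halfTurn (v 0 - v (i + 1)) (v 0 - v (i + 2)) =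
      ∏ i ∈ Finset.range (m + 1), halfTurn (v (i + 1) - v 0) (v (i + 2) - v 0) :=
    Finset.prod_congr rfl fun i _ => by rw [← halfTurn_neg_neg, neg_sub, neg_sub]
  rw [Finset.prod_range_succ _ m] at hA
  have hfin := halfTurn_mul_halfTurn_neg hp hq
  rw [neg_sub] at hfin
  rw [Finset.prod_range_succ, hpath, ← ht,
    Finset.prod_range_succ' (fun i => halfTurn (v (m + 1 + 1) - v i) _) m]
  simp only [add_assoc, Nat.reduceAdd, zero_add, add_comm 1, hv, neg_sub] at hs hsq hA hfin hcorner ⊢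
  have key (P S c₀ u z t c₁ B H Q : ℂ) (h₁ : S * u = c₁ * B) (h₂ : c₀ * c₁ = H) (h₃ : B * z = P)
      (h₄ : P ^ 2 = Q) (h₅ : Q * H * t = -1) : P * (S * c₀) * (u * z) * t = -1 := by
    linear_combination P * c₀ * z * t * h₁ + P * z * t * B * h₂ + P * H * t * h₃ + H * t * h₄ + h₅
  exact key _ _ _ _ _ _ _ _ _ _ hs hcorner hA hsq hfin

end Polygon

namespace PlaneGraph

variable (G : PlaneGraph)

lemma zero_notMem_segment_sub {a b c : G.V} (hab : s(a, b) ∈ G.E) (hbc : s(b, c) ∈ G.E)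
    (hac : a ≠ c) : (0 : ℂ) ∉ segment ℝ (G.pos b - G.pos a) (G.pos c - G.pos b) := by
  have hab' : a ≠ b := fun h => G.not_diag _ hab (by simpa using h)
  have hbc' : b ≠ c := fun h => G.not_diag _ hbc (by simpa using h)
  rintro ⟨s, t, hs, ht, hst, h⟩
  rcases le_or_gt t s with hle | hlt
  · have hs0 : 0 < s := by linarith
    have hmem : G.pos a ∈ segOf G.pos s(b, c) := by
      refine ⟨1 - t / s, t / s, ?_, by positivity, by ring, ?_⟩
      · rw [sub_nonneg, div_le_one hs0]
        exact hle
      · have hs' : (s : ℂ) ≠ 0 := by exact_mod_cast hs0.ne'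
        simp only [Complex.real_smul] at h ⊢
        push_cast
        field_simp
        linear_combination h
    have := G.vertex_on_edge _ hbc a hmem
    simp [hab', hac] at this
  · have ht0 : 0 < t := by linarith
    have hmem : G.pos c ∈ segOf G.pos s(a, b) := by
      refine ⟨s / t, 1 - s / t, by positivity, ?_, by ring, ?_⟩
      · rw [sub_nonneg, div_le_one ht0]
        exact hlt.le
      · have ht' : (t : ℂ) ≠ 0 := by exact_mod_cast ht0.ne'
        simp only [Complex.real_smul] at h ⊢
        push_cast
        field_simp
        linear_combination -h
    have := G.vertex_on_edge _ hab c hmem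
    simp [hbc'.symm, hac.symm] at this

lemma disjoint_segment {a b c d : G.V} (hab : s(a, b) ∈ G.E) (hcd : s(c, d) ∈ G.E)
    (hac : a ≠ c) (had : a ≠ d) (hbc : b ≠ c) (hbd : b ≠ d) :
    Disjoint (segment ℝ (G.pos a) (G.pos b)) (segment ℝ (G.pos c) (G.pos d)) := by
  rw [Set.disjoint_left]
  intro p h1 h2
  obtain ⟨w, hw1, hw2, -⟩ := G.edges_meet _ hab _ hcd (by simp [hac, had]) p h1 h2
  rw [Sym2.mem_iff] at hw1 hw2
  grind

end PlaneGraph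

lemma prod_zipWith_tail {α M : Type*} [CommMonoid M] (f : α → α → M) (d : α) (l : List α) :
    (List.zipWith f l l.tail).prod =
      ∏ i ∈ Finset.range (l.length - 1), f (l.getD i d) (l.getD (i + 1) d) := by
  induction l with
  | nil => simp
  | cons a l ih =>
    cases l with
    | nil => simp
    | cons b l =>
      simp only [List.tail_cons, List.zipWith_cons_cons, List.prod_cons, List.length_cons,
        Nat.add_sub_cancel] at ih ⊢
      rw [ih, Finset.prod_range_succ', mul_comm]
      simp

lemma prod_map_dropLast {α M : Type*} [CommMonoid M] (f : α → M) (d : α) (l : List α) :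
    (l.dropLast.map f).prod = ∏ i ∈ Finset.range (l.length - 1), f (l.getD i d) := by
  induction l with
  | nil => simp
  | cons a l ih =>
    cases l with
    | nil => simp
    | cons b l =>
      simp only [List.dropLast_cons_cons, List.map_cons, List.prod_cons, List.length_cons,
        Nat.add_sub_cancel] at ih ⊢
      rw [ih, Finset.prod_range_succ', mul_comm]
      simp

lemma countP_dropLast_eq_card {α : Type*} (p : α → Bool) (d : α) (l : List α) :
    l.dropLast.countP p =
      ((Finset.range (l.length - 1)).filter fun i => p (l.getD i d)).card := by
  rw [Finset.card_filter]
  induction l with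
  | nil => simp
  | cons a l ih =>
    cases l with
    | nil => simp
    | cons b l =>
      simp only [List.dropLast_cons_cons, List.countP_cons, List.length_cons,
        Nat.add_sub_cancel] at ih ⊢
      rw [ih, Finset.sum_range_succ']
      simp

namespace PlaneGraph

/-- The tails of the steps of a self-avoiding loop are pairwise distinct. -/
lemma SelfAvoiding.tail_ne {G : PlaneGraph} {l : List G.DEdge} (hl : G.SelfAvoiding l)
    (d : G.DEdge)
    (hstep : ∀ i, i + 1 < l.length → (l.getD i d).val.2 = (l.getD (i + 1) d).val.1)
    {i j : ℕ} (hij : i < j) (hj : j < l.length - 1) :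
    (l.getD i d).val.1 ≠ (l.getD j d).val.1 := by
  intro h
  have hne (e : G.DEdge) : e.val.1 ≠ e.val.2 := fun h => G.not_diag _ e.2 (by simpa using h)
  obtain rfl | hlt := Nat.eq_or_lt_of_le (Nat.succ_le_of_lt hij)
  · exact hne (l.getD i d) (by rw [hstep i (by omega)]; exact h)
  obtain ⟨k, rfl⟩ : ∃ k, j = k + 1 := ⟨j - 1, by omega⟩
  have hk := hstep k (by omega)
  have hc := hl.2 (l.getD i d).val.1
  rw [countP_dropLast_eq_card _ d] at hc
  have hsub : ({i, k, k + 1} : Finset ℕ) ⊆ (Finset.range (l.length - 1)).filter fun m =>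
      decide ((l.getD i d).val.1 = (l.getD m d).val.1 ∨
        (l.getD i d).val.1 = (l.getD m d).val.2) = true := by
    intro m hm
    simp only [Finset.mem_insert, Finset.mem_singleton] at hm
    simp only [Finset.mem_filter, Finset.mem_range, decide_eq_true_eq]
    obtain rfl | rfl | rfl := hm
    · exact ⟨by omega, Or.inl rfl⟩
    · exact ⟨by omega, Or.inr (h.trans hk.symm)⟩
    · exact ⟨by omega, Or.inl h⟩
  have hcard := Finset.card_le_card hsub
  rw [Finset.card_eq_three.2 ⟨i, k, k + 1, by omega, by omega, by omega, rfl⟩] at hcard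
  have := hc (by omega)
  omega

end PlaneGraph

/-- For any self-avoiding loop `ℓ`, `λ(ℓ) = -x(ℓ)`. -/
theorem wlam_self_avoiding (G : PlaneGraph) (x : Sym2 G.V → ℝ)
    (l : List G.DEdge) (hl : G.SelfAvoiding l) :
    G.wlam x l = -((G.wx x l : ℝ) : ℂ) := by
  obtain ⟨⟨⟨-, hchain⟩, hlen, hends⟩, -⟩ := id hl
  obtain ⟨d, hd⟩ : ∃ d, l.head? = some d := by
    cases l with
    | nil => simp at hlen
    | cons a l => exact ⟨a, rfl⟩
  have hstep : ∀ i, i + 1 < l.length → (l.getD i d).val.2 = (l.getD (i + 1) d).val.1 ∧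
      l.getD (i + 1) d ≠ G.rev (l.getD i d) := by
    intro i hi
    have h := List.isChain_iff_getElem.1 hchain i hi
    rwa [List.getD_eq_getElem _ _ (by omega), List.getD_eq_getElem _ _ hi]
  have htail {i j : ℕ} (hij : i < j) (hj : j < l.length - 1) :=
    hl.tail_ne d (fun i hi => (hstep i hi).1) hij hj
  have hfirst : l.getD 0 d = d := by
    simp [List.getD_eq_getElem?_getD, ← List.head?_eq_getElem?, hd]
  have hlast : l.getD (l.length - 1) d = d := by
    rw [List.getD_eq_getElem?_getD, ← List.getLast?_eq_getElem?, ← hends, hd]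
    rfl
  obtain ⟨m, hm⟩ : ∃ m, l.length = m + 4 := by
    refine ⟨l.length - 4, ?_⟩
    by_contra hcon
    have h3 : l.length = 3 := by omega
    rw [h3] at hlast
    have h0 := hstep 0 (by omega)
    have h1 := (hstep 1 (by omega)).1
    rw [hlast] at h1
    rw [hfirst] at h0
    exact h0.2 (Subtype.ext (Prod.ext h0.1.symm h1))
  set e : ℕ → G.DEdge := fun i => l.getD i d
  set v : ℕ → ℂ := fun i => G.pos (e i).val.1
  have hedge : ∀ i < m + 3, s((e i).val.1, (e (i + 1)).val.1) ∈ G.E := by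
    intro i hi
    rw [← (hstep i (by omega)).1]
    exact (e i).2
  have hne : ∀ i j, i < j → j < m + 3 → (e i).val.1 ≠ (e j).val.1 :=
    fun i j h1 h2 => htail h1 (by omega)
  have hwrap : e (m + 3) = e 0 := by
    have : l.length - 1 = m + 3 := by omega
    rw [this] at hlast
    exact hlast.trans hfirst.symm
  have hwrap' : (e (m + 3)).val.1 = (e 0).val.1 := by rw [hwrap]
  have hpoly := prod_halfTurn_polygon (v := v) m (congrArg G.pos hwrap')
    (fun j h1 h2 h => hne 0 j h1 h2 (G.pos_inj h).symm)
    (fun i j h1 h2 h3 => G.disjoint_segment (hedge i (by omega)) (hedge j (by omega))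
      (hne i j (by omega) h2)
      (by
        obtain hj | rfl := Nat.lt_or_eq_of_le (Nat.le_of_lt_succ h2)
        · exact hne i (j + 1) (by omega) (by omega)
        · rw [hwrap']
          exact (hne 0 i (by omega) (by omega)).symm)
      (hne (i + 1) j h1 h2)
      (by
        obtain hj | rfl := Nat.lt_or_eq_of_le (Nat.le_of_lt_succ h2)
        · exact hne (i + 1) (j + 1) (by omega) (by omega)
        · rw [hwrap']
          exact (hne 0 (i + 1) (by omega) (by omega)).symm))
    (fun i hi => G.zero_notMem_segment_sub (hedge i (by omega)) (hedge (i + 1) (by omega))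
      (by
        obtain hi | rfl := Nat.lt_or_eq_of_le (Nat.le_of_lt_succ hi)
        · exact hne i (i + 2) (by omega) (by omega)
        · rw [hwrap']
          exact (hne 0 (m + 1) (by omega) (by omega)).symm))
    (G.zero_notMem_segment_sub (by rw [← hwrap']; exact hedge (m + 2) (by omega))
      (hedge 0 (by omega)) (hne 1 (m + 2) (by omega) (by omega)).symm)
  have hhead : ∀ i < m + 3, G.pos (e i).val.2 - G.pos (e i).val.1 = v (i + 1) - v i := by
    intro i hi
    rw [(hstep i (by omega)).1]
  have hhead_last : G.pos (e (m + 3)).val.2 - G.pos (e (m + 3)).val.1 = v 1 - v 0 := by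
    rw [hwrap, hhead 0 (by omega)]
  have hlen' : l.length - 1 = m + 3 := by omega
  have hterm : ∀ i < m + 3, G.transMatrix x (e i) (e (i + 1)) =
      (x (G.undir (e i)) : ℂ) * Complex.exp (Complex.I / 2 * (G.tangle (e i) (e (i + 1)) : ℂ)) :=
    fun i hi => if_pos (hstep i (by omega))
  rw [PlaneGraph.wlam, PlaneGraph.wx, prod_zipWith_tail _ d, prod_map_dropLast _ d, hlen',
    Finset.prod_congr rfl fun i hi => hterm i (Finset.mem_range.1 hi), Finset.prod_mul_distrib,
    Complex.ofReal_prod, ← mul_neg_one, ← hpoly]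
  congr 1
  rw [Finset.prod_range_succ]
  congr 1
  · refine Finset.prod_congr rfl fun i hi => ?_
    have hi := Finset.mem_range.1 hi
    rw [PlaneGraph.tangle, hhead i (by omega), hhead (i + 1) (by omega)]
    rfl
  · rw [PlaneGraph.tangle, hhead (m + 2) (by omega), hhead_last,
      show v (m + 2 + 1) = v 0 from congrArg G.pos hwrap']
    rfl
end

section
/- Fix a directed edge e and suppose ‖x‖_∞ = max_{ē∈E} |x_ē| < 1/(Δ−1), where Δ ≥ 2 is the maximum vertex degree of 𝒢. Let 𝓛¹_e be the set of loops rooted at e which visit e exactly once and never visit −e. Then exp(−Σ_ℓ λ(ℓ)/|ℓ|) = 1 − Σ_{ℓ∈𝓛¹_e} λ(ℓ), where the sum in the exponential ranges over all rooted loops ℓ that visit e at least once and never visit −e. -/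
open scoped BigOperators

namespace Matrix

open Polynomial in
/-- The determinant of a polynomial in a complex matrix is the product of the values of the
polynomial at the eigenvalues. -/
theorem det_aeval_eq_prod_roots_charpoly {n K : Type*} [Fintype n] [DecidableEq n] [Field K]
    [IsAlgClosed K] (A : Matrix n n K) (q : K[X]) :
    (aeval A q).det = (A.charpoly.roots.map fun μ => q.eval μ).prod := by
  have hcard : A.charpoly.roots.card = Fintype.card n := by
    rw [← (IsAlgClosed.splits A.charpoly).natDegree_eq_card_roots, charpoly_natDegree_eq_dim]
  have hlin (c : K) : (aeval A (X - C c)).det = (A.charpoly.roots.map fun μ => μ - c).prod := by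
    have h := (IsAlgClosed.splits A.charpoly).eval_eq_prod_roots_of_monic (charpoly_monic A) c
    rw [eval_charpoly] at h
    have hneg : aeval A (X - C c) = -(scalar n c - A) := by
      simp [algebraMap_eq_diagonal]
    rw [hneg, det_neg, h, ← hcard, ← Multiset.card_map (fun μ => c - μ), ← Multiset.prod_map_neg]
    simp
  have hprod (s : Multiset K) : (aeval A (s.map fun c => X - C c).prod).det =
      (A.charpoly.roots.map fun μ => ((s.map fun c => X - C c).prod).eval μ).prod := by
    induction s using Multiset.induction_on with
    | empty => simp
    | cons c s ih => simp [det_mul, ih, ← hlin, Multiset.prod_map_mul]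
  conv_lhs => rw [(IsAlgClosed.splits q).eq_prod_roots]
  conv_rhs => rw [(IsAlgClosed.splits q).eq_prod_roots]
  rw [map_mul, det_mul, hprod]
  simp [hcard, algebraMap_eq_diagonal, Multiset.prod_map_mul]

open Polynomial in
theorem roots_charpoly_pow {n K : Type*} [Fintype n] [DecidableEq n] [Field K]
    [IsAlgClosed K] (A : Matrix n n K) (k : ℕ) :
    (A ^ k).charpoly.roots = A.charpoly.roots.map (· ^ k) := by
  have h : (A ^ k).charpoly = ((A.charpoly.roots.map (· ^ k)).map fun c => X - C c).prod := by
    refine Polynomial.funext fun z => ?_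
    have hz : scalar n z - A ^ k = aeval A (C z - X ^ k) := by
      simp [algebraMap_eq_diagonal]
    rw [eval_charpoly, hz, det_aeval_eq_prod_roots_charpoly, eval_multiset_prod]
    simp
  rw [h, roots_multiset_prod_X_sub_C]

theorem trace_pow_eq_sum_roots_charpoly {n K : Type*} [Fintype n] [DecidableEq n] [Field K]
    [IsAlgClosed K] (A : Matrix n n K) (k : ℕ) :
    (A ^ k).trace = (A.charpoly.roots.map (· ^ k)).sum := by
  rw [trace_eq_sum_roots_charpoly, roots_charpoly_pow]

open scoped Matrix.Norms.Operator

/-- `exp (-∑ tr Aᵏ / k) = det (1 - A)` for a matrix of operator norm less than one. -/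
theorem exists_hasSum_trace_pow_div_exp_neg {n : Type*} [Fintype n] [DecidableEq n] [Nonempty n]
    (A : Matrix n n ℂ) (hA : ‖A‖ < 1) :
    ∃ s : ℂ, HasSum (fun k : ℕ => (A ^ k).trace / k) s ∧ Complex.exp (-s) = (1 - A).det := by
  have hroot : ∀ μ ∈ A.charpoly.roots, ‖μ‖ < 1 := fun μ hμ =>
    (spectrum.norm_le_norm_of_mem
      (mem_spectrum_of_isRoot_charpoly (Polynomial.isRoot_of_mem_roots hμ))).trans_lt hA
  have hdet : (1 - A).det = (A.charpoly.roots.map fun μ => 1 - μ).prod := by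
    have h := (IsAlgClosed.splits A.charpoly).eval_eq_prod_roots_of_monic (charpoly_monic A) 1
    rwa [eval_charpoly, map_one] at h
  simp_rw [hdet, trace_pow_eq_sum_roots_charpoly]
  generalize A.charpoly.roots = t at hroot
  induction t using Multiset.induction_on with
  | empty => exact ⟨0, by simp, by simp⟩
  | cons μ t ih =>
    obtain ⟨s, hs, he⟩ := ih fun ν hν => hroot ν (Multiset.mem_cons_of_mem hν)
    have hμ := hroot μ (Multiset.mem_cons_self μ t)
    refine ⟨-Complex.log (1 - μ) + s, ?_, ?_⟩
    · simpa [add_div] using (Complex.hasSum_taylorSeries_neg_log hμ).add hs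
    · have hne : 1 - μ ≠ 0 := sub_ne_zero.2 fun h => by simp [← h] at hμ
      rw [neg_add, neg_neg, Complex.exp_add, Complex.exp_log hne, he]
      simp

/-- Clearing the row `e` of `A` changes `det (1 - A)` by the weight of the excursions from `e`. -/
theorem exists_hasSum_mul_updateRow_pow {n : Type*} [Fintype n] [DecidableEq n]
    (A : Matrix n n ℂ) (e : n) (hA : ‖A.updateRow e 0‖ < 1) :
    ∃ s : ℂ, HasSum (fun k : ℕ => (A * A.updateRow e 0 ^ k) e e) s ∧
      (1 - A).det = (1 - A.updateRow e 0).det * (1 - s) := by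
  set B := A.updateRow e 0 with hB
  have hsum := (summable_geometric_of_norm_lt_one hA).hasSum
  have hinv := mul_neg_geom_series B hA
  set T := ∑' k : ℕ, B ^ k
  have hunit : IsUnit (1 - B).det := isUnit_det_of_right_inverse hinv
  have hsum' : HasSum (fun k : ℕ => (A * B ^ k) e e) ((A * T) e e) := by
    have h := hsum.mul_left A
    exact Pi.hasSum.1 (Pi.hasSum.1 h e) e
  refine ⟨_, hsum', ?_⟩
  have hrank : 1 - A =
      (1 - B) + replicateCol Unit (Pi.single e (-1 : ℂ)) * replicateRow Unit (A e) := by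
    ext i j
    by_cases h : i = e
    · subst h; simp [hB, mul_apply, sub_eq_add_neg]
    · simp [hB, mul_apply, h]
  rw [hrank, det_add_replicateCol_mul_replicateRow hunit, inv_eq_right_inv hinv]
  congr 1
  simp [det_unique, mul_apply, Pi.single_apply, sub_eq_add_neg]
  rfl

end Matrix

namespace Matrix

/-- The product of the entries of `M` along consecutive elements of a list. -/
def pathWeight {α R : Type*} [MulOneClass R] (M : Matrix α α R) (l : List α) : R :=
  (List.zipWith (fun a b => M a b) l l.tail).prod

section PathWeight

variable {α R : Type*}

@[simp]
theorem pathWeight_singleton [MulOneClass R] (M : Matrix α α R) (a : α) :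
    M.pathWeight [a] = 1 := by simp [pathWeight]

@[simp]
theorem pathWeight_cons_cons [Monoid R] (M : Matrix α α R) (a b : α) (l : List α) :
    M.pathWeight (a :: b :: l) = M a b * M.pathWeight (b :: l) := by simp [pathWeight]

theorem pathWeight_updateRow_zero [DecidableEq α] [MonoidWithZero R] (M : Matrix α α R) (e : α)
    (l : List α) :
    (M.updateRow e 0).pathWeight l = if e ∈ l.dropLast then 0 else M.pathWeight l := by
  induction l with
  | nil => simp [pathWeight]
  | cons a l ih =>
    cases l with
    | nil => simp
    | cons b l =>
      rw [pathWeight_cons_cons, ih, pathWeight_cons_cons]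
      by_cases h : a = e
      · simp [h]
      · by_cases h' : e ∈ (b :: l).dropLast <;> simp [h, h', Ne.symm h]

theorem pathWeight_eq_zero_of_not_isChain [MonoidWithZero R] (M : Matrix α α R) {r : α → α → Prop}
    (hr : ∀ a b, ¬ r a b → M a b = 0) {l : List α} (hl : ¬ l.IsChain r) : M.pathWeight l = 0 := by
  induction l with
  | nil => simp at hl
  | cons a l ih =>
    cases l with
    | nil => simp at hl
    | cons b l =>
      rw [List.isChain_cons_cons, not_and_or] at hl
      rw [pathWeight_cons_cons]
      rcases hl with hl | hl
      · rw [hr a b hl, zero_mul]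
      · rw [ih hl, mul_zero]

theorem _root_.Fin.sum_univ_cons_ofFn [Fintype α] {M : Type*} [AddCommMonoid M] (n : ℕ)
    (f : List α → M) :
    ∑ v : Fin (n + 1) → α, f (List.ofFn v) = ∑ a : α, ∑ v : Fin n → α, f (a :: List.ofFn v) := by
  rw [← (Fin.consEquiv fun _ => α).sum_comp, Fintype.sum_prod_type]
  simp [Fin.consEquiv, List.ofFn_succ]

theorem sum_pathWeight_eq_pow_apply [Fintype α] [DecidableEq α] [CommSemiring R]
    (M : Matrix α α R) (n : ℕ) (a b : α) :
    (∑ v : Fin n → α, if (a :: List.ofFn v).getLast? = some b then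
      M.pathWeight (a :: List.ofFn v) else 0) = (M ^ n) a b := by
  induction n generalizing a with
  | zero => simp [one_apply]
  | succ n ih =>
    rw [Fin.sum_univ_cons_ofFn n fun l => if (a :: l).getLast? = some b then
      M.pathWeight (a :: l) else 0, pow_succ', mul_apply]
    refine Finset.sum_congr rfl fun c _ => ?_
    rw [← ih c, Finset.mul_sum]
    simp [List.getLast?_cons_cons]

open scoped Matrix.Norms.Operator

theorem sum_norm_apply_le_norm {m n : Type*} [Fintype m] [Fintype n] (A : Matrix m n ℂ) (i : m) :
    ∑ j, ‖A i j‖ ≤ ‖A‖ := by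
  rw [linfty_opNorm_def]
  have h := Finset.le_sup (f := fun i => ∑ j, ‖A i j‖₊) (Finset.mem_univ i)
  simpa only [NNReal.coe_sum, coe_nnnorm] using NNReal.coe_le_coe.2 h

theorem linfty_opNorm_lt_one {m n : Type*} [Fintype m] [Fintype n] {A : Matrix m n ℂ}
    (hA : ∀ i, ∑ j, ‖A i j‖ < 1) : ‖A‖ < 1 := by
  rw [linfty_opNorm_def, NNReal.coe_lt_one, Finset.sup_lt_iff (by simp)]
  intro i _
  rw [← NNReal.coe_lt_one]
  simpa only [NNReal.coe_sum, coe_nnnorm] using hA i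

theorem linfty_opNorm_updateRow_zero_le {m n : Type*} [Fintype m] [Fintype n] [DecidableEq m]
    (A : Matrix m n ℂ) (e : m) : ‖A.updateRow e 0‖ ≤ ‖A‖ := by
  simp only [linfty_opNorm_def, NNReal.coe_le_coe]
  refine Finset.sup_mono_fun fun i _ => Finset.sum_le_sum fun j _ => ?_
  by_cases h : i = e <;> simp [h]

theorem sum_norm_pathWeight_le [Fintype α] [DecidableEq α] (M : Matrix α α ℂ) (n : ℕ) (a : α) :
    ∑ v : Fin n → α, ‖M.pathWeight (a :: List.ofFn v)‖ ≤ ‖M‖ ^ n := by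
  induction n generalizing a with
  | zero => simp
  | succ n ih =>
    rw [Fin.sum_univ_cons_ofFn n fun l => ‖M.pathWeight (a :: l)‖]
    calc
      _ = ∑ c, ‖M a c‖ * ∑ v : Fin n → α, ‖M.pathWeight (c :: List.ofFn v)‖ := by
        simp [Finset.mul_sum]
      _ ≤ ∑ c, ‖M a c‖ * ‖M‖ ^ n := by gcongr with c; exact ih c
      _ ≤ ‖M‖ * ‖M‖ ^ n := by
        rw [← Finset.sum_mul]; gcongr; exact sum_norm_apply_le_norm M a
      _ = ‖M‖ ^ (n + 1) := (pow_succ' _ _).symm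

/-- A function on lists dominated by the path weights of a contraction can be summed by length. -/
theorem hasSum_sum_cons_ofFn_of_norm_le_pathWeight [Fintype α] [DecidableEq α] (M : Matrix α α ℂ)
    (hM : ‖M‖ < 1) {f : List α → ℂ} (hnil : f [] = 0) (hf : ∀ l, ‖f l‖ ≤ ‖M.pathWeight l‖) :
    HasSum (fun n => ∑ a, ∑ v : Fin n → α, f (a :: List.ofFn v)) (∑' l, f l) := by
  let u : (Σ n, Fin n → α) → ℂ := fun p => f (List.ofFn p.2)
  have hu : Summable u := by
    refine Summable.of_norm ((summable_sigma_of_nonneg fun _ => norm_nonneg _).2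
      ⟨fun n => (hasSum_fintype _).summable, ?_⟩)
    simp only [tsum_fintype]
    refine (summable_nat_add_iff 1).1 (Summable.of_nonneg_of_le
      (fun n => Finset.sum_nonneg fun _ _ => norm_nonneg _) (fun n => ?_)
      ((summable_geometric_of_lt_one (norm_nonneg M) hM).mul_left (Fintype.card α : ℝ)))
    calc
      _ = ∑ a, ∑ v : Fin n → α, ‖f (a :: List.ofFn v)‖ :=
        Fin.sum_univ_cons_ofFn n fun l => ‖f l‖
      _ ≤ ∑ a : α, ‖M‖ ^ n := by
        gcongr with a
        exact (Finset.sum_le_sum fun v _ => hf _).trans (sum_norm_pathWeight_le M n a)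
      _ = _ := by simp
  have htsum : ∑' l, f l = ∑' p, u p := (List.equivSigmaTuple.symm.tsum_eq f).symm
  have hsig := hu.hasSum.sigma fun n => hasSum_fintype fun v => u ⟨n, v⟩
  rw [htsum]
  have hshift := (hasSum_nat_add_iff' 1).2 hsig
  have hzero : ∑ n ∈ Finset.range 1, ∑ v : Fin n → α, u ⟨n, v⟩ = 0 := by simp [u, hnil]
  rw [hzero, sub_zero] at hshift
  exact hshift.congr_fun fun n => (Fin.sum_univ_cons_ofFn n f).symm

/-- The sum over all closed lists through `e`, weighted by inverse length, is minus the logarithm of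
one minus the sum over the closed lists which return to their root `e` for the first time. -/
theorem exp_neg_tsum_pathWeight_div_length [Fintype α] [DecidableEq α] [BEq α] [LawfulBEq α]
    (M : Matrix α α ℂ) (hM : ‖M‖ < 1) (e : α) :
    Complex.exp (-∑' l : List α, if l.head? = l.getLast? ∧ e ∈ l.dropLast then
        M.pathWeight l / ((l.length - 1 : ℕ) : ℂ) else 0) =
      1 - ∑' l : List α, if l.head? = some e ∧ l.getLast? = some e ∧ l.dropLast.count e = 1 then
        M.pathWeight l else 0 := by
  have : Nonempty α := ⟨e⟩
  have hB : ‖M.updateRow e 0‖ < 1 := (linfty_opNorm_updateRow_zero_le M e).trans_lt hM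
  obtain ⟨s, hs, hdet⟩ := exists_hasSum_trace_pow_div_exp_neg M hM
  obtain ⟨t, ht, hdetB⟩ := exists_hasSum_trace_pow_div_exp_neg _ hB
  obtain ⟨r, hr, hrel⟩ := exists_hasSum_mul_updateRow_pow M e hB
  have htrace (A : Matrix α α ℂ) (n : ℕ) : (A ^ n).trace = ∑ a, ∑ v : Fin n → α,
      if (a :: List.ofFn v).getLast? = some a then A.pathWeight (a :: List.ofFn v) else 0 := by
    simp_rw [sum_pathWeight_eq_pow_apply]
    rfl
  have hclosed := hasSum_sum_cons_ofFn_of_norm_le_pathWeight M hM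
    (f := fun l => if l.head? = l.getLast? ∧ e ∈ l.dropLast then
        M.pathWeight l / ((l.length - 1 : ℕ) : ℂ) else 0) (by simp) fun l => by
      split_ifs with h
      · rw [norm_div, Complex.norm_natCast]
        rcases Nat.eq_zero_or_pos (l.length - 1) with h0 | h0
        · simp [h0]
        · exact div_le_self (norm_nonneg _) (by exact_mod_cast h0)
      · simp
  have hfirst := hasSum_sum_cons_ofFn_of_norm_le_pathWeight M hM
    (f := fun l => if l.head? = some e ∧ l.getLast? = some e ∧ l.dropLast.count e = 1 then
        M.pathWeight l else 0) (by simp) fun l => by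
      split_ifs <;> simp
  have hclosed_eq := hclosed.unique <| (hs.sub ht).congr_fun fun n => by
    rw [htrace, htrace, ← sub_div, ← Finset.sum_sub_distrib, Finset.sum_div]
    refine Finset.sum_congr rfl fun a _ => ?_
    rw [← Finset.sum_sub_distrib, Finset.sum_div]
    refine Finset.sum_congr rfl fun v _ => ?_
    rw [pathWeight_updateRow_zero]
    by_cases h : (a :: List.ofFn v).getLast? = some a <;>
      by_cases h' : e ∈ (a :: List.ofFn v).dropLast <;> simp [h, h', eq_comm (a := some a)]
  have hfirst_eq := hfirst.unique <| (hasSum_nat_add_iff' 1).1 <| by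
    rw [Finset.sum_eq_zero (by simp), sub_zero]
    refine hr.congr_fun fun n => ?_
    rw [Finset.sum_eq_single e (fun a _ ha => by simp [ha]) (by simp),
      Fin.sum_univ_cons_ofFn n fun l => if (e :: l).head? = some e ∧ (e :: l).getLast? = some e ∧
        (e :: l).dropLast.count e = 1 then M.pathWeight (e :: l) else 0, mul_apply]
    refine Finset.sum_congr rfl fun c _ => ?_
    rw [← sum_pathWeight_eq_pow_apply, Finset.mul_sum]
    refine Finset.sum_congr rfl fun v _ => ?_
    rw [pathWeight_updateRow_zero]
    by_cases h : (c :: List.ofFn v).getLast? = some e <;>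
      by_cases h' : e ∈ (c :: List.ofFn v).dropLast <;>
        simp [h, h', List.getLast?_cons_cons, List.count_eq_zero]
  rw [hclosed_eq, hfirst_eq, neg_sub, sub_eq_neg_add, Complex.exp_add, hdet, hrel, ← hdetB,
    mul_right_comm, ← Complex.exp_add]
  simp

end PathWeight

end Matrix

namespace PlaneGraph

variable (G : PlaneGraph)

theorem dedge_fst_ne_snd (e : G.DEdge) : e.val.1 ≠ e.val.2 := fun h =>
  G.not_diag _ e.property (by simpa using h)

theorem transMatrix_self (x : Sym2 G.V → ℝ) (e : G.DEdge) : G.transMatrix x e e = 0 :=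
  if_neg fun h => G.dedge_fst_ne_snd e h.1.symm

theorem wlam_eq_pathWeight (x : Sym2 G.V → ℝ) (l : List G.DEdge) :
    G.wlam x l = (G.transMatrix x).pathWeight l := rfl

/-- A directed edge has at most `deg - 1` non-backtracking continuations. -/
theorem card_continuations_lt_degV (e : G.DEdge) :
    (Finset.univ.filter fun g : G.DEdge => e.val.2 = g.val.1 ∧ g ≠ G.rev e).card <
      G.degV e.val.2 := by
  have hrev : G.undir (G.rev e) ∈ G.E.filter (e.val.2 ∈ ·) := by
    simpa [undir, rev] using (G.rev e).property
  rw [degV, ← Finset.card_erase_add_one hrev, Nat.lt_succ_iff]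
  refine Finset.card_le_card_of_injOn G.undir (fun g hg => ?_) fun g hg g' hg' h => ?_
  · obtain ⟨hg₁, hg₂⟩ : e.val.2 = g.val.1 ∧ g ≠ G.rev e := by simpa using hg
    have hne : G.undir g ≠ G.undir (G.rev e) := fun h => by
      rw [undir, undir, ← hg₁] at h
      exact hg₂ (Subtype.ext (Prod.ext hg₁.symm (Sym2.congr_right.1 h)))
    refine Finset.mem_erase.2 ⟨hne, Finset.mem_filter.2 ⟨g.property, ?_⟩⟩
    rw [hg₁]
    exact Sym2.mem_mk_left _ _
  · have h₁ : e.val.2 = g.val.1 := by simp at hg; exact hg.1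
    have h₂ : e.val.2 = g'.val.1 := by simp at hg'; exact hg'.1
    rw [undir, undir, ← h₁, ← h₂] at h
    exact Subtype.ext (Prod.ext (h₁.symm.trans h₂) (Sym2.congr_right.1 h))

open scoped Matrix.Norms.Operator

theorem norm_transMatrix_lt_one (x : Sym2 G.V → ℝ) (Δ : ℕ) (hΔ : 2 ≤ Δ)
    (hdeg : ∀ v : G.V, G.degV v ≤ Δ) (hx : ∀ e ∈ G.E, |x e| < 1 / ((Δ : ℝ) - 1)) :
    ‖G.transMatrix x‖ < 1 := by
  refine Matrix.linfty_opNorm_lt_one fun e => ?_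
  have hΔ' : (0 : ℝ) < Δ - 1 := by
    have : (2 : ℝ) ≤ Δ := by exact_mod_cast hΔ
    linarith
  have hnorm (g : G.DEdge) : ‖G.transMatrix x e g‖ =
      if e.val.2 = g.val.1 ∧ g ≠ G.rev e then |x (G.undir e)| else 0 := by
    unfold transMatrix
    split_ifs with h
    · rw [norm_mul, Complex.norm_exp]
      simp
    · simp
  have hcard : ((Finset.univ.filter fun g : G.DEdge =>
      e.val.2 = g.val.1 ∧ g ≠ G.rev e).card : ℝ) ≤ Δ - 1 := by
    rw [le_sub_iff_add_le]
    exact_mod_cast (G.card_continuations_lt_degV e).trans_le (hdeg _)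
  simp_rw [hnorm]
  rw [← Finset.sum_filter, Finset.sum_const, nsmul_eq_mul]
  calc
    _ ≤ ((Δ : ℝ) - 1) * |x (G.undir e)| := by gcongr
    _ < 1 := by
      have := hx _ e.property
      rwa [lt_div_iff₀' hΔ'] at this

/-- Clearing the row `-e` of `Λ` restricts the path weight to the lists which do not visit `-e`;
the closed ones among them of non-zero weight are loops. -/
theorem pathWeight_updateRow_rev_of_head?_eq_getLast? (x : Sym2 G.V → ℝ) (e : G.DEdge)
    {l : List G.DEdge} (hl : l.head? = l.getLast?) (hne : l.dropLast ≠ []) :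
    ((G.transMatrix x).updateRow (G.rev e) 0).pathWeight l =
      open Classical in if G.IsLoop l ∧ G.visits l (G.rev e) = 0 then G.wlam x l else 0 := by
  rw [Matrix.pathWeight_updateRow_zero, wlam_eq_pathWeight]
  by_cases hrev : G.rev e ∈ l.dropLast
  · simp [hrev, visits, List.count_eq_zero]
  by_cases hloop : G.IsLoop l
  · simp [hrev, hloop, visits, List.count_eq_zero]
  rw [if_neg hrev, if_neg fun h => hloop h.1]
  by_cases hchain : l.IsChain fun e g => e.val.2 = g.val.1 ∧ g ≠ G.rev e
  · rcases l with _ | ⟨a, _ | ⟨b, _ | ⟨c, l⟩⟩⟩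
    · simp at hne
    · simp at hne
    · obtain rfl : a = b := by simpa using hl
      simp [transMatrix_self]
    · exact absurd ⟨⟨by simp, hchain⟩, by simp, hl⟩ hloop
  · exact Matrix.pathWeight_eq_zero_of_not_isChain _ (fun a b h => if_neg h) hchain

end PlaneGraph

/-- **Generic cancellations.** For a fixed directed edge `e` and small
weights, `exp(-w{ℓ visits e and not -e}) = 1 - λ(𝓛¹_e)`, where `𝓛¹_e` is the
set of loops rooted at `e` which visit `e` exactly once and never visit `-e`. -/
theorem exp_neg_loop_sum_eq_one_sub (G : PlaneGraph) (x : Sym2 G.V → ℝ)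
    (Δ : ℕ) (hΔ : 2 ≤ Δ) (hdeg : ∀ v : G.V, G.degV v ≤ Δ)
    (hx : ∀ e ∈ G.E, |x e| < 1 / ((Δ : ℝ) - 1)) (e : G.DEdge) :
    Complex.exp (- ∑' ℓ : {l : List G.DEdge //
          G.IsLoop l ∧ 1 ≤ G.visits l e ∧ G.visits l (G.rev e) = 0},
        G.wlam x ℓ.val / (G.len ℓ.val : ℂ)) =
    1 - ∑' ℓ : {l : List G.DEdge //
          G.IsLoop l ∧ l.head? = some e ∧ G.visits l e = 1 ∧ G.visits l (G.rev e) = 0},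
        G.wlam x ℓ.val := by
  classical
  have h := Matrix.exp_neg_tsum_pathWeight_div_length
    ((G.transMatrix x).updateRow (G.rev e) 0)
    ((Matrix.linfty_opNorm_updateRow_zero_le _ _).trans_lt
      (G.norm_transMatrix_lt_one x Δ hΔ hdeg hx)) e
  refine (congrArg (fun z => Complex.exp (-z)) ((tsum_subtype {l : List G.DEdge |
      G.IsLoop l ∧ 1 ≤ G.visits l e ∧ G.visits l (G.rev e) = 0} fun l =>
        G.wlam x l / (G.len l : ℂ)).trans (tsum_congr fun l => ?_))).trans
    (h.trans (congrArg (fun z => 1 - z) ((tsum_subtype {l : List G.DEdge |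
      G.IsLoop l ∧ l.head? = some e ∧ G.visits l e = 1 ∧ G.visits l (G.rev e) = 0}
        (G.wlam x)).trans (tsum_congr fun l => ?_)).symm))
  · by_cases hl : l.head? = l.getLast? ∧ e ∈ l.dropLast
    · rw [if_pos hl, G.pathWeight_updateRow_rev_of_head?_eq_getLast? x e hl.1
        (List.ne_nil_of_mem hl.2)]
      have hv : 1 ≤ G.visits l e := List.one_le_count_iff.2 hl.2
      simp [Set.indicator_apply, hv, PlaneGraph.len, ite_div]
    · rw [if_neg hl, Set.indicator_of_notMem]
      exact fun h => hl ⟨h.1.2.2, List.one_le_count_iff.1 h.2.1⟩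
  · by_cases hl : l.head? = some e ∧ l.getLast? = some e ∧ l.dropLast.count e = 1
    · have he : e ∈ l.dropLast := List.one_le_count_iff.1 hl.2.2.ge
      rw [if_pos hl, G.pathWeight_updateRow_rev_of_head?_eq_getLast? x e (hl.1.trans hl.2.1.symm)
        (List.ne_nil_of_mem he)]
      have hv : G.visits l e = 1 := hl.2.2
      simp [Set.indicator_apply, hl.1, hv]
    · rw [if_neg hl, Set.indicator_of_notMem]
      exact fun h => hl ⟨h.2.1, h.1.2.2 ▸ h.2.1, h.2.2.1⟩
end
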